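/- arXiv:2509.06207 — 5 statements merged into one kernel-verified Lean document; each statement's English description precedes it below -/
import Mathlib

section
/- Let k ≥ 2 be an integer. For every integer n ≥ 2k, the family ℬ_n(C_{2k}) of all 2k-cycles in the complete bipartite graph K_{n,n} is an EKR family, and for every integer n > 2k it is a strong EKR family. -/
/-- A family of finite sets is *intersecting* if any two of its members share an element. -/
def IsIntersectingFamily {α : Type*} (ℬ : Set (Finset α)) : Prop :=
  ∀ A ∈ ℬ, ∀ B ∈ ℬ, ∃ x, x ∈ A ∧ x ∈ B

/-- The subfamily of all members of `𝒜` that contain `x`. -/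
def famAt {α : Type*} (𝒜 : Set (Finset α)) (x : α) : Set (Finset α) :=
  {A ∈ 𝒜 | x ∈ A}

/-- `𝒜` is an *EKR family* over the ground set `X`: for every `x ∈ X`, the subfamily
`famAt 𝒜 x` has maximum cardinality among all intersecting subfamilies of `𝒜`. -/
def IsEKRFamily {α : Type*} (X : Set α) (𝒜 : Set (Finset α)) : Prop :=
  ∀ x ∈ X, ∀ ℬ ⊆ 𝒜, IsIntersectingFamily ℬ → ℬ.ncard ≤ (famAt 𝒜 x).ncard

/-- `𝒜` is a *strong EKR family* over the ground set `X`: it is an EKR family and moreover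
every intersecting subfamily of maximum cardinality equals `famAt 𝒜 x` for some `x ∈ X`. -/
def IsStrongEKRFamily {α : Type*} (X : Set α) (𝒜 : Set (Finset α)) : Prop :=
  IsEKRFamily X 𝒜 ∧ ∀ ℬ ⊆ 𝒜, IsIntersectingFamily ℬ →
    (∀ 𝒞 ⊆ 𝒜, IsIntersectingFamily 𝒞 → 𝒞.ncard ≤ ℬ.ncard) → ∃ x ∈ X, ℬ = famAt 𝒜 x

/-- The family of all cycles of length `k` in the complete bipartite graph `K_{n,n}`,
each cycle being identified with its edge set. -/
def bipCycleFamily (n k : ℕ) : Set (Finset (Sym2 (Fin n ⊕ Fin n))) :=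
  {E | ∃ (v : Fin n ⊕ Fin n) (w : (completeBipartiteGraph (Fin n) (Fin n)).Walk v v),
      w.IsCycle ∧ w.length = k ∧ E = w.edges.toFinset}

namespace BC
open Finset

/-- the edge set of the cycle `ρ 0, γ 0, ...` written as a set of cells -/
def cyc {W : Type*} [DecidableEq W] {k : ℕ} [NeZero k] (ρ γ : ZMod k → W) : Finset (W × W) :=
  univ.image (fun i => (ρ i, γ i)) ∪ univ.image (fun i => (ρ i, γ (i + 1)))

/-- transport of a set of cells -/
def mv {P V : Type*} [DecidableEq V] (σ τ : P ≃ V) (E : Finset (P × P)) : Finset (V × V) :=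
  E.image (Prod.map σ τ)

theorem mv_cyc {P V : Type*} [DecidableEq V] [DecidableEq P] {k : ℕ} [NeZero k] (σ τ : P ≃ V)
    (ρ γ : ZMod k → P) : mv σ τ (cyc ρ γ) = cyc (σ ∘ ρ) (τ ∘ γ) := by
  simp [mv, cyc, image_union, image_image, Function.comp_def, Prod.map]

theorem mv_mv {P Q V : Type*} [DecidableEq V] [DecidableEq Q] (σ τ : Q ≃ V)
    (α β : P ≃ Q) (E : Finset (P × P)) :
    mv σ τ (mv α β E) = mv (α.trans σ) (β.trans τ) E := by
  simp only [mv, image_image]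
  rfl

theorem mv_inj {P V : Type*} [DecidableEq V] (σ τ : P ≃ V) {E F : Finset (P × P)}
    (h : mv σ τ E = mv σ τ F) : E = F :=
  Finset.image_injective (σ.injective.prodMap τ.injective) h

theorem card_cyc {W : Type*} [DecidableEq W] {k : ℕ} [NeZero k] (hk : 2 ≤ k) {ρ γ : ZMod k → W}
    (hρ : ρ.Injective) (hγ : γ.Injective) : #(cyc ρ γ) = 2 * k := by
  unfold cyc
  rw [card_union_of_disjoint, card_image_of_injective, card_image_of_injective]
  · simp [ZMod.card]; omega
  · intro a b h; exact hρ (by simpa using congrArg Prod.fst h)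
  · intro a b h; exact hρ (by simpa using congrArg Prod.fst h)
  · rw [Finset.disjoint_left]
    intro x hx hy
    simp only [mem_image, mem_univ, true_and] at hx hy
    obtain ⟨i, rfl⟩ := hx
    obtain ⟨j, hj⟩ := hy
    have h1 := hρ (congrArg Prod.fst hj)
    have h2 := hγ (congrArg Prod.snd hj)
    subst h1
    have : (1 : ZMod k) = 0 := by simpa using h2
    have : Fact (1 < k) := ⟨by omega⟩
    exact one_ne_zero ‹(1 : ZMod k) = 0›

/-- the family of cycles -/
def IsCyc (k : ℕ) [NeZero k] {V : Type*} [DecidableEq V] (E : Finset (V × V)) : Prop :=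
  ∃ ρ γ : ZMod k → V, ρ.Injective ∧ γ.Injective ∧ E = cyc ρ γ

/-- initial labels -/
def lab (n k : ℕ) (i : ZMod k) : ZMod n := (i.val : ZMod n)

theorem lab_inj {n k : ℕ} [NeZero k] (h : k ≤ n) : (lab n k).Injective := by
  intro i j hij
  unfold lab at hij
  rw [ZMod.natCast_eq_natCast_iff] at hij
  have hi := ZMod.val_lt i
  have hj := ZMod.val_lt j
  exact ZMod.val_injective k (Nat.ModEq.eq_of_lt_of_lt hij (by omega) (by omega))

theorem exists_ext {n k : ℕ} [NeZero k] [NeZero n] {V : Type*} [Fintype V] [DecidableEq V]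
    (hV : Fintype.card V = n) {ι : ZMod k → ZMod n} (hι : ι.Injective) {f : ZMod k → V}
    (hf : f.Injective) : ∃ σ : ZMod n ≃ V, σ ∘ ι = f := by
  have h1 : Fintype.card (ZMod n) = #(univ : Finset V) := by
    rw [ZMod.card, card_univ, hV]
  obtain ⟨g, hg⟩ := Finset.exists_equiv_extend_of_card_eq (α := ZMod n) (β := V) h1
    (s := univ.image ι) (f := fun x => f (Function.invFun ι x)) (subset_univ _) (by
      intro x hx y hy hxy
      simp only [coe_image, coe_univ, Set.image_univ, Set.mem_range] at hx hy
      obtain ⟨a, rfl⟩ := hx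
      obtain ⟨b, rfl⟩ := hy
      simp only [Function.leftInverse_invFun hι _] at hxy
      rw [hf hxy])
  refine ⟨g.trans (Equiv.subtypeUnivEquiv (by simp)), ?_⟩
  funext i
  have := hg (ι i) (by simp)
  simp only [Function.leftInverse_invFun hι _] at this
  simpa using this

section count
variable {n k : ℕ} [NeZero k] [NeZero n] {V : Type*} [Fintype V] [DecidableEq V]

/-- base cycle -/
def E0 (n k : ℕ) [NeZero k] : Finset (ZMod n × ZMod n) := cyc (lab n k) (lab n k)

/-- number of labellings carrying the base cycle into the family -/
def Nn (n k : ℕ) [NeZero k] [NeZero n] {V : Type*} [Fintype V] [DecidableEq V]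
    (B : Finset (Finset (V × V))) : ℕ :=
  #{g : (ZMod n ≃ V) × (ZMod n ≃ V) | mv g.1 g.2 (E0 n k) ∈ B}

theorem isCyc_iff (hV : Fintype.card V = n) (hkn : k ≤ n) (E : Finset (V × V)) :
    IsCyc k E ↔ ∃ σ τ : ZMod n ≃ V, mv σ τ (E0 n k) = E := by
  constructor
  · rintro ⟨ρ, γ, hρ, hγ, rfl⟩
    obtain ⟨σ, hσ⟩ := exists_ext hV (lab_inj hkn) hρ
    obtain ⟨τ, hτ⟩ := exists_ext hV (lab_inj hkn) hγ
    exact ⟨σ, τ, by rw [E0, mv_cyc, hσ, hτ]⟩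
  · rintro ⟨σ, τ, rfl⟩
    exact ⟨_, _, σ.injective.comp (lab_inj hkn), τ.injective.comp (lab_inj hkn), by
      rw [E0, mv_cyc]⟩

theorem Nn_eq (hV : Fintype.card V = n) (hkn : k ≤ n) : ∃ s, 0 < s ∧
    ∀ B : Finset (Finset (V × V)), (∀ E ∈ B, IsCyc k E) → Nn n k B = s * #B := by
  refine ⟨#{g : (ZMod n ≃ ZMod n) × (ZMod n ≃ ZMod n) | mv g.1 g.2 (E0 n k) = E0 n k}, ?_, ?_⟩
  · rw [card_pos]
    refine ⟨(Equiv.refl _, Equiv.refl _), ?_⟩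
    rw [mem_filter]
    exact ⟨mem_univ _, by simp [mv]⟩
  · intro B hB
    unfold Nn
    rw [card_eq_sum_card_fiberwise (t := B) (f := fun g => mv g.1 g.2 (E0 n k))
      (by intro g hg; simpa using hg), sum_const_nat, mul_comm]
    intro E hE
    obtain ⟨σ, τ, rfl⟩ := (isCyc_iff hV hkn E).1 (hB E hE)
    refine card_bij' (fun g _ => (g.1.trans σ.symm, g.2.trans τ.symm))
      (fun g _ => (g.1.trans σ, g.2.trans τ)) ?_ ?_ ?_ ?_
    · intro g hg
      simp only [mem_filter, mem_univ, true_and] at hg ⊢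
      rw [← mv_mv, hg.2, mv_mv]
      simp [mv]
    · intro g hg
      simp only [mem_filter, mem_univ, true_and] at hg ⊢
      rw [← mv_mv, hg]
      exact ⟨hE, rfl⟩
    · intro g hg; ext <;> simp
    · intro g hg; ext <;> simp

theorem Nn_shift (hV : Fintype.card V = n) (hkn : k ≤ n) (B : Finset (Finset (V × V)))
    {ρ γ : ZMod k → ZMod n} (hρ : ρ.Injective) (hγ : γ.Injective) :
    Nn n k B = #{g : (ZMod n ≃ V) × (ZMod n ≃ V) | mv g.1 g.2 (cyc ρ γ) ∈ B} := by
  obtain ⟨α, hα⟩ := exists_ext (V := ZMod n) (ZMod.card n) (lab_inj hkn) hρ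
  obtain ⟨β, hβ⟩ := exists_ext (V := ZMod n) (ZMod.card n) (lab_inj hkn) hγ
  have h : cyc ρ γ = mv α β (E0 n k) := by rw [E0, mv_cyc, hα, hβ]
  unfold Nn
  symm
  refine card_bij' (fun g _ => (α.trans g.1, β.trans g.2))
      (fun g _ => (α.symm.trans g.1, β.symm.trans g.2)) ?_ ?_ ?_ ?_
  · intro g hg
    simp only [mem_filter, mem_univ, true_and] at hg ⊢
    rw [← mv_mv, ← h]; exact hg
  · intro g hg
    simp only [mem_filter, mem_univ, true_and] at hg ⊢
    rw [h, mv_mv]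
    simpa [← Equiv.trans_assoc] using hg
  · intro g hg; ext <;> simp
  · intro g hg; ext <;> simp

theorem Nn_transl (hV : Fintype.card V = n) (hkn : k ≤ n) (B : Finset (Finset (V × V)))
    {I : Type*} [Fintype I] {ρ γ : I → ZMod k → ZMod n} (hρ : ∀ i, (ρ i).Injective)
    (hγ : ∀ i, (γ i).Injective) :
    Fintype.card I * Nn n k B = ∑ g : (ZMod n ≃ V) × (ZMod n ≃ V),
      #{i : I | mv g.1 g.2 (cyc (ρ i) (γ i)) ∈ B} := by
  simp_rw [card_filter]
  rw [sum_comm]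
  simp_rw [← card_filter]
  rw [sum_congr rfl (fun i _ => (Nn_shift hV hkn B (hρ i) (hγ i)).symm)]
  simp

theorem pt_count (hV : Fintype.card V = n) (p : ZMod n) (r : V) :
    n * #{σ : ZMod n ≃ V | σ p = r} = Fintype.card (ZMod n ≃ V) := by
  have h : ∀ r', #{σ : ZMod n ≃ V | σ p = r'} = #{σ : ZMod n ≃ V | σ p = r} := by
    intro r'
    refine card_bij' (fun σ _ => σ.trans (Equiv.swap r r')) (fun σ _ => σ.trans (Equiv.swap r r'))
      ?_ ?_ ?_ ?_
    · intro σ hσ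
      simp only [mem_filter, mem_univ, true_and] at hσ ⊢
      simp [hσ]
    · intro σ hσ
      simp only [mem_filter, mem_univ, true_and] at hσ ⊢
      simp [hσ]
    · intro g hg; ext; simp
    · intro g hg; ext; simp
  have h2 := card_eq_sum_card_fiberwise (s := (univ : Finset (ZMod n ≃ V)))
    (t := (univ : Finset V)) (f := fun σ => σ p) (by intro g hg; simp)
  rw [sum_congr rfl (fun r' _ => h r')] at h2
  rw [← card_univ, h2]
  simp [hV]

theorem star_count (hV : Fintype.card V = n) (hk : 2 ≤ k) (hkn : k ≤ n)
    (S : Finset (Finset (V × V))) (e : V × V)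
    (hS : ∀ E, E ∈ S ↔ IsCyc k E ∧ e ∈ E) :
    n * n * Nn n k S = 2 * k * Fintype.card ((ZMod n ≃ V) × (ZMod n ≃ V)) := by
  have h1 : Nn n k S = ∑ c ∈ E0 n k,
      #{g : (ZMod n ≃ V) × (ZMod n ≃ V) | g.1 c.1 = e.1 ∧ g.2 c.2 = e.2} := by
    unfold Nn
    rw [← card_biUnion]
    · congr 1
      ext g
      simp only [mem_filter, mem_univ, true_and, mem_biUnion, hS]
      constructor
      · rintro ⟨-, h⟩
        simp only [mv, mem_image] at h
        obtain ⟨c, hc, rfl⟩ := h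
        exact ⟨c, hc, rfl, rfl⟩
      · rintro ⟨c, hc, h1, h2⟩
        refine ⟨(isCyc_iff hV hkn _).2 ⟨_, _, rfl⟩, ?_⟩
        simp only [mv, mem_image]
        exact ⟨c, hc, Prod.ext h1 h2⟩
    · intro c hc d hd hcd
      rw [Function.onFun, Finset.disjoint_left]
      intro g hg hg'
      simp only [mem_filter, mem_univ, true_and] at hg hg'
      exact hcd (Prod.ext (g.1.injective (hg.1.trans hg'.1.symm))
        (g.2.injective (hg.2.trans hg'.2.symm)))
  rw [h1, mul_sum, sum_congr rfl (g := fun _ => Fintype.card ((ZMod n ≃ V) × (ZMod n ≃ V)))]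
  · rw [sum_const, E0, card_cyc hk (lab_inj hkn) (lab_inj hkn), smul_eq_mul]
  · intro c hc
    have : (univ.filter fun g : (ZMod n ≃ V) × (ZMod n ≃ V) => g.1 c.1 = e.1 ∧ g.2 c.2 = e.2)
      = (univ.filter fun σ : ZMod n ≃ V => σ c.1 = e.1) ×ˢ
        (univ.filter fun σ : ZMod n ≃ V => σ c.2 = e.2) := by
      ext g; simp
    rw [this, card_product, Fintype.card_prod]
    nth_rewrite 1 [← pt_count hV c.1 e.1]
    rw [← pt_count hV c.2 e.2]
    ring

/-- Katona averaging: bound and tightness. -/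
theorem katona (hV : Fintype.card V = n) (hk : 2 ≤ k) (hkn : k ≤ n)
    (S B : Finset (Finset (V × V))) (e : V × V)
    (hS : ∀ E, E ∈ S ↔ IsCyc k E ∧ e ∈ E) (hB : ∀ E ∈ B, IsCyc k E)
    {I : Type*} [Fintype I] [Nonempty I] {ρ γ : I → ZMod k → ZMod n}
    (hρ : ∀ i, (ρ i).Injective) (hγ : ∀ i, (γ i).Injective)
    (hI : ∀ σ τ : ZMod n ≃ V,
      n * n * #{i : I | mv σ τ (cyc (ρ i) (γ i)) ∈ B} ≤ 2 * k * Fintype.card I) :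
    #B ≤ #S ∧ (#B = #S → ∀ σ τ : ZMod n ≃ V,
      n * n * #{i : I | mv σ τ (cyc (ρ i) (γ i)) ∈ B} = 2 * k * Fintype.card I) := by
  obtain ⟨s, hs, hN⟩ := Nn_eq (k := k) hV hkn
  have hNB := hN B hB
  have hNS := hN S (fun E hE => ((hS E).1 hE).1)
  have hst := star_count hV hk hkn S e hS
  have hcf := Nn_transl hV hkn B hρ hγ
  have hsum : n * n * (Fintype.card I * Nn n k B) = ∑ g : (ZMod n ≃ V) × (ZMod n ≃ V),
      n * n * #{i : I | mv g.1 g.2 (cyc (ρ i) (γ i)) ∈ B} := by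
    rw [hcf, mul_sum]
  have hrhs : ∑ g : (ZMod n ≃ V) × (ZMod n ≃ V), 2 * k * Fintype.card I
      = n * n * (Fintype.card I * Nn n k S) := by
    rw [sum_const, card_univ, smul_eq_mul]
    calc _ = Fintype.card I * (2 * k * Fintype.card ((ZMod n ≃ V) × (ZMod n ≃ V))) := by ring
      _ = _ := by rw [← hst]; ring
  have hn : 0 < n := Nat.pos_of_ne_zero (NeZero.ne n)
  have hIpos : 0 < Fintype.card I := Fintype.card_pos
  constructor
  · have : n * n * (Fintype.card I * Nn n k B) ≤ n * n * (Fintype.card I * Nn n k S) := by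
      rw [hsum, ← hrhs]
      exact sum_le_sum fun g _ => hI g.1 g.2
    have := Nat.le_of_mul_le_mul_left this (by positivity)
    have := Nat.le_of_mul_le_mul_left this hIpos
    rw [hNB, hNS] at this
    exact Nat.le_of_mul_le_mul_left this hs
  · intro hcard σ τ
    have heq : Nn n k B = Nn n k S := by rw [hNB, hNS, hcard]
    rw [heq, ← hrhs] at hsum
    exact ((sum_eq_sum_iff_of_le (fun g _ => hI g.1 g.2)).1 hsum.symm (σ, τ) (mem_univ _))

end count
end BC

namespace BC
open Finset

theorem nat_inj {n a b : ℕ} (ha : a < n) (hb : b < n) (h : (a : ZMod n) = (b : ZMod n)) :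
    a = b := by
  rw [ZMod.natCast_eq_natCast_iff] at h
  exact Nat.ModEq.eq_of_lt_of_lt h ha hb

theorem nat_ne {n a : ℕ} (h0 : 0 < a) (ha : a < n) : (a : ZMod n) ≠ 0 := by
  intro h
  have := nat_inj (b := 0) ha (by omega) (by simpa using h)
  omega

/-- the arcs of length `k` starting at `x` and `y` meet -/
def Near (n k : ℕ) (x y : ZMod n) : Prop := ∃ i < k, ∃ j < k, x + (i : ZMod n) = y + (j : ZMod n)

theorem not_near {n k d : ℕ} (h1 : k ≤ d) (h2 : d + k ≤ n) (x y : ZMod n)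
    (hxy : y = x + (d : ZMod n)) : ¬ Near n k x y := by
  rintro ⟨i, hi, j, hj, h⟩
  have : ((i : ℕ) : ZMod n) = ((d + j : ℕ) : ZMod n) := by
    push_cast
    rw [hxy] at h
    linear_combination h
  have := nat_inj (by omega) (by omega) this
  omega

theorem near_iff {n k : ℕ} {x y : ZMod n} (h : Near n k x y) :
    ∃ d < k, y = x + (d : ZMod n) ∨ x = y + (d : ZMod n) := by
  obtain ⟨i, hi, j, hj, h⟩ := h
  rcases le_total j i with hij | hij
  · obtain ⟨d, rfl⟩ := Nat.exists_eq_add_of_le hij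
    refine ⟨d, by omega, Or.inl ?_⟩
    push_cast at h
    linear_combination -h
  · obtain ⟨d, rfl⟩ := Nat.exists_eq_add_of_le hij
    refine ⟨d, by omega, Or.inr ?_⟩
    push_cast at h
    linear_combination h

theorem near_res {n k : ℕ} {x y : ZMod n} (h : Near n k x y) :
    ∃ r < k, y = x + (r : ZMod n) ∨ y + (k : ZMod n) = x + (r : ZMod n) := by
  obtain ⟨d, hd, h | h⟩ := near_iff h
  · exact ⟨d, hd, Or.inl h⟩
  · rcases Nat.eq_zero_or_pos d with rfl | h0
    · exact ⟨0, hd, Or.inl (by rw [h]; simp)⟩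
    · refine ⟨k - d, by omega, Or.inr ?_⟩
      rw [Nat.cast_sub hd.le, h]
      ring

theorem circle_bound {n k : ℕ} (hn : 2 * k ≤ n) (X : Finset (ZMod n))
    (hX : ∀ x ∈ X, ∀ y ∈ X, Near n k x y) :
    #X ≤ k ∧ (#X = k → ∀ x0 ∈ X, ∀ r < k, x0 + (r : ZMod n) ∈ X ∨
      ∃ x ∈ X, x + (k : ZMod n) = x0 + (r : ZMod n)) := by
  have key : ∀ x0 ∈ X, ∃ f : ZMod n → ℕ, (∀ x ∈ X, f x ∈ range k) ∧ Set.InjOn f X ∧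
      ∀ x ∈ X, x = x0 + (f x : ZMod n) ∨ x + (k : ZMod n) = x0 + (f x : ZMod n) := by
    intro x0 hx0
    have : ∀ x : ZMod n, ∃ r : ℕ, x ∈ X → r < k ∧
        (x = x0 + (r : ZMod n) ∨ x + (k : ZMod n) = x0 + (r : ZMod n)) := by
      intro x
      by_cases hx : x ∈ X
      · obtain ⟨r, hr, h⟩ := near_res (hX x0 hx0 x hx)
        exact ⟨r, fun _ => ⟨hr, h⟩⟩
      · exact ⟨0, fun h => absurd h hx⟩
    choose f hf using this
    refine ⟨f, fun x hx => mem_range.2 (hf x hx).1, ?_, fun x hx => (hf x hx).2⟩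
    intro x hx y hy hxy
    have hx1 := (hf x hx).2
    have hy1 := (hf y hy).2
    rw [hxy] at hx1
    rcases hx1 with h1 | h1 <;> rcases hy1 with h2 | h2
    · exact h1.trans h2.symm
    · exact absurd (hX y hy x hx) (not_near le_rfl (by omega) y x (h1.trans h2.symm))
    · exact absurd (hX x hx y hy) (not_near le_rfl (by omega) x y (h2.trans h1.symm))
    · exact add_right_cancel (h1.trans h2.symm)
  constructor
  · rcases X.eq_empty_or_nonempty with rfl | ⟨x0, hx0⟩
    · simp
    · obtain ⟨f, hf, hinj, -⟩ := key x0 hx0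
      simpa using card_le_card_of_injOn f hf hinj
  · intro hc x0 hx0 r hr
    obtain ⟨f, hf, hinj, h⟩ := key x0 hx0
    obtain ⟨x, hx, rfl⟩ := Finset.surjOn_of_injOn_of_card_le f hf hinj (by simp [hc])
      (by simpa using hr : r ∈ (range k : Set ℕ))
    rcases h x hx with h1 | h1
    · left; rw [← h1]; exact hx
    · right; exact ⟨x, hx, h1⟩

theorem circle_tight {n k : ℕ} (hk : 1 ≤ k) (hn : 2 * k < n) (X : Finset (ZMod n))
    (hX : ∀ x ∈ X, ∀ y ∈ X, Near n k x y) (hc : #X = k) :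
    ∃ c : ZMod n, ∀ x, x ∈ X ↔ ∃ i < k, x = c + (i : ZMod n) := by
  obtain ⟨x0, hx0⟩ : X.Nonempty := by rw [← card_pos]; omega
  have hr := (circle_bound (by omega) X hX).2 hc x0 hx0
  have hex : ∃ m : ℕ, x0 + (m : ZMod n) ∉ X :=
    ⟨k, fun h => not_near le_rfl (by omega) _ _ rfl (hX x0 hx0 _ h)⟩
  classical
  obtain ⟨m, hm, hmin⟩ : ∃ m : ℕ, x0 + (m : ZMod n) ∉ X ∧ ∀ j < m, x0 + (j : ZMod n) ∈ X :=
    ⟨Nat.find hex, Nat.find_spec hex, fun j hj => by simpa using Nat.find_min hex hj⟩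
  have hmk : m ≤ k := by
    by_contra h
    exact not_near le_rfl (by omega) _ _ rfl (hX x0 hx0 _ (hmin k (by omega)))
  have hup : ∀ r, m ≤ r → r < k → x0 + (r : ZMod n) ∉ X := by
    intro r hmr
    induction r, hmr using Nat.le_induction with
    | base => intro _; exact hm
    | succ r hmr ih =>
      intro hrk hmem
      rcases hr r (by omega) with h | ⟨x, hx, h⟩
      · exact ih (by omega) h
      · refine not_near (d := k + 1) (by omega) (by omega) x _ ?_ (hX x hx _ hmem)
        push_cast
        linear_combination -h
  refine ⟨x0 + m - k, ?_⟩
  have hsub : (range k).image (fun i : ℕ => x0 + (m : ZMod n) - k + (i : ZMod n)) ⊆ X := by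
    intro x hx
    simp only [mem_image, mem_range] at hx
    obtain ⟨i, hi, rfl⟩ := hx
    rcases le_or_gt k (m + i) with h | h
    · have := hmin (m + i - k) (by omega)
      rw [Nat.cast_sub h] at this
      push_cast at this
      convert this using 1
      ring
    · rcases hr (m + i) h with h1 | ⟨x, hx, h1⟩
      · exact absurd h1 (hup _ (by omega) h)
      · convert hx using 1
        push_cast at h1
        linear_combination -h1
  have hcard : #((range k).image (fun i : ℕ => x0 + (m : ZMod n) - k + (i : ZMod n))) = k := by
    rw [card_image_of_injOn, card_range]
    intro i hi j hj hij
    simp only [coe_range, Set.mem_Iio] at hi hj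
    exact nat_inj (by omega) (by omega) (add_left_cancel hij)
  have := eq_of_subset_of_card_le hsub (by rw [hcard, hc])
  intro x
  rw [← this]
  simp [eq_comm]

section setstar
variable {n k : ℕ} [NeZero n] {V : Type*} [Fintype V] [DecidableEq V]

/-- arcs of a circular order -/
def arcS (k : ℕ) (σ : ZMod n ≃ V) (x : ZMod n) : Finset V :=
  (range k).image (fun i : ℕ => σ (x + (i : ZMod n)))

theorem near_of_arcS {σ : ZMod n ≃ V} {x y : ZMod n} {v : V} (hx : v ∈ arcS k σ x)
    (hy : v ∈ arcS k σ y) : Near n k x y := by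
  simp only [arcS, mem_image, mem_range] at hx hy
  obtain ⟨i, hi, rfl⟩ := hx
  obtain ⟨j, hj, h⟩ := hy
  exact ⟨i, hi, j, hj, (σ.injective h).symm⟩

theorem card_arcS (hkn : k ≤ n) (σ : ZMod n ≃ V) (x : ZMod n) : #(arcS k σ x) = k := by
  rw [arcS, card_image_of_injOn, card_range]
  intro i hi j hj hij
  simp only [coe_range, Set.mem_Iio] at hi hj
  exact nat_inj (by omega) (by omega) (add_left_cancel (σ.injective hij))

theorem arcS_swap (σ : ZMod n ≃ V) (p x : ZMod n) (h1 : x ≠ p + 1) (h2 : x + (k : ZMod n) ≠ p + 1) :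
    arcS k ((Equiv.swap p (p + 1)).trans σ) x = arcS k σ x := by
  have hA : ∀ y, (∃ i < k, x + (i : ZMod n) = y) →
      ∃ i < k, x + (i : ZMod n) = Equiv.swap p (p + 1) y := by
    rintro y ⟨i, hi, rfl⟩
    rw [Equiv.swap_apply_def]
    split_ifs with ha hb
    · refine ⟨i + 1, ?_, by push_cast; rw [← ha]; ring⟩
      by_contra hc
      have : k = i + 1 := by omega
      apply h2
      rw [this, ← ha]; push_cast; ring
    · obtain _ | i := i
      · exact absurd (by simpa using hb) h1
      · refine ⟨i, by omega, ?_⟩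
        push_cast at hb
        linear_combination hb
    · exact ⟨i, hi, rfl⟩
  ext v
  simp only [arcS, mem_image, mem_range, Equiv.trans_apply]
  constructor
  · rintro ⟨i, hi, rfl⟩
    obtain ⟨j, hj, h⟩ := hA _ ⟨i, hi, rfl⟩
    exact ⟨j, hj, by rw [h]⟩
  · rintro ⟨i, hi, rfl⟩
    obtain ⟨j, hj, h⟩ := hA _ ⟨i, hi, rfl⟩
    exact ⟨j, hj, by rw [h, Equiv.swap_apply_self]⟩

/-- the circular order `σ` is centred at `a` -/
def Good (k : ℕ) (R : Set (Finset V)) (a : V) (σ : ZMod n ≃ V) : Prop :=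
  σ 0 = a ∧ ∀ x, arcS k σ x ∈ R ↔ ∃ i < k, x + (i : ZMod n) = 0

theorem good_swap {R : Set (Finset V)} {a : V} (hk : 2 ≤ k) (hn : 2 * k < n)
    (ht : ∀ σ : ZMod n ≃ V, ∃ c : ZMod n, ∀ x, arcS k σ x ∈ R ↔ ∃ i < k, x = c + (i : ZMod n))
    {σ : ZMod n ≃ V} (hσ : Good k R a σ) {p : ZMod n} (hp : p ≠ 0) (hp1 : p + 1 ≠ 0) :
    Good k R a ((Equiv.swap p (p + 1)).trans σ) := by
  obtain ⟨h0, hX⟩ := hσ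
  refine ⟨by simp [Equiv.swap_apply_of_ne_of_ne hp.symm hp1.symm, h0], ?_⟩
  obtain ⟨k, rfl⟩ : ∃ k', k = k' + 2 := ⟨k - 2, by omega⟩
  obtain ⟨c, hc⟩ := ht ((Equiv.swap p (p + 1)).trans σ)
  have hun : ∀ x, x ≠ p + 1 → x + ((k + 2 : ℕ) : ZMod n) ≠ p + 1 →
      ((∃ i < k + 2, x = c + (i : ZMod n)) ↔ ∃ i < k + 2, x + (i : ZMod n) = 0) := by
    intro x h1 h2
    rw [← hc, arcS_swap σ p x h1 h2, hX]
  suffices hcz : c + ((k + 1 : ℕ) : ZMod n) = 0 by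
    intro x
    rw [hc]
    constructor
    · rintro ⟨i, hi, rfl⟩
      refine ⟨k + 1 - i, by omega, ?_⟩
      rw [Nat.cast_sub (by omega)]
      linear_combination hcz
    · rintro ⟨i, hi, h⟩
      refine ⟨k + 1 - i, by omega, ?_⟩
      rw [Nat.cast_sub (by omega)]
      linear_combination h - hcz
  by_cases hB : (p + 1 : ZMod n) = ((k + 2 : ℕ) : ZMod n)
  · have hz := (hun (-((k + 1 : ℕ) : ZMod n)) (by
        rw [hB]; intro h
        refine nat_ne (n := n) (a := 2 * k + 3) (by omega) (by omega) ?_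
        push_cast at h ⊢; linear_combination -h) (by
        rw [hB]; intro h
        refine nat_ne (n := n) (a := k + 1) (by omega) (by omega) ?_
        push_cast at h ⊢; linear_combination -h)).2 ⟨k + 1, by omega, by ring⟩
    have h1 := (hun (-1) (by
        rw [hB]; intro h
        refine nat_ne (n := n) (a := k + 3) (by omega) (by omega) ?_
        push_cast at h ⊢; linear_combination -h) (by
        rw [hB]; intro h
        refine nat_ne (n := n) (a := 1) (by omega) (by omega) ?_
        push_cast at h ⊢; linear_combination -h)).2 ⟨1, by omega, by simp⟩
    have h2 := (hun (-((k + 2 : ℕ) : ZMod n)) (by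
        rw [hB]; intro h
        refine nat_ne (n := n) (a := 2 * k + 4) (by omega) (by omega) ?_
        push_cast at h ⊢; linear_combination -h) (by
        rw [hB]; intro h
        refine nat_ne (n := n) (a := k + 2) (by omega) (by omega) ?_
        push_cast at h ⊢; linear_combination -h)).1
    obtain ⟨i, hi, hz⟩ := hz
    obtain ⟨j, hj, h1⟩ := h1
    have : i + k = j := nat_inj (n := n) (by omega) (by omega) (by
      push_cast at hz ⊢; linear_combination h1 - hz)
    obtain rfl | rfl : i = 0 ∨ i = 1 := by omega
    · push_cast at hz ⊢; linear_combination -hz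
    · obtain ⟨l, hl, h3⟩ := h2 ⟨0, by omega, by push_cast at hz ⊢; linear_combination hz⟩
      have : l = k + 2 := nat_inj (n := n) (by omega) (by omega) (by
        linear_combination h3)
      omega
  · have h0 := (hun 0 (fun h => hp1 h.symm) (by rw [zero_add]; exact fun h => hB h.symm)).2
      ⟨0, by omega, by simp⟩
    by_cases hC : (p + 1 : ZMod n) = -((k + 1 : ℕ) : ZMod n)
    · have hz := (hun (-((k : ℕ) : ZMod n)) (by
          rw [hC]; intro h
          refine nat_ne (n := n) (a := 1) (by omega) (by omega) ?_
          push_cast at h ⊢; linear_combination h) (by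
          rw [hC]; intro h
          refine nat_ne (n := n) (a := k + 3) (by omega) (by omega) ?_
          push_cast at h ⊢; linear_combination h)).2 ⟨k, by omega, by ring⟩
      have h2 := (hun 1 (by
          rw [hC]; intro h
          refine nat_ne (n := n) (a := k + 2) (by omega) (by omega) ?_
          push_cast at h ⊢; linear_combination h) (by
          rw [hC]; intro h
          refine nat_ne (n := n) (a := 2 * k + 4) (by omega) (by omega) ?_
          push_cast at h ⊢; linear_combination h)).1
      obtain ⟨i, hi, hz⟩ := hz
      obtain ⟨j, hj, h1⟩ := h0
      have : i + k = j := nat_inj (n := n) (by omega) (by omega) (by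
        push_cast at hz ⊢; linear_combination h1 - hz)
      obtain rfl | rfl : i = 0 ∨ i = 1 := by omega
      · obtain ⟨l, hl, h3⟩ := h2 ⟨k + 1, by omega, by
          push_cast at hz ⊢; linear_combination hz⟩
        exact absurd (show ((l + 1 : ℕ) : ZMod n) = 0 by push_cast; linear_combination h3)
          (nat_ne (by omega) (by omega))
      · push_cast at hz ⊢; linear_combination -hz
    · have hz := (hun (-((k + 1 : ℕ) : ZMod n)) (fun h => hC h.symm) (by
          intro h
          apply hp
          push_cast at h
          linear_combination -h)).2 ⟨k + 1, by omega, by ring⟩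
      obtain ⟨i, hi, hz⟩ := hz
      obtain ⟨j, hj, h1⟩ := h0
      have : i + (k + 1) = j := nat_inj (n := n) (by omega) (by omega) (by
        push_cast at hz ⊢; linear_combination h1 - hz)
      obtain rfl : i = 0 := by omega
      push_cast at hz ⊢; linear_combination -hz

theorem good_swap_nat {R : Set (Finset V)} {a : V} (hk : 2 ≤ k) (hn : 2 * k < n)
    (ht : ∀ σ : ZMod n ≃ V, ∃ c : ZMod n, ∀ x, arcS k σ x ∈ R ↔ ∃ i < k, x = c + (i : ZMod n))
    (p m : ℕ) (hp : 1 ≤ p) (hpm : p + m < n) :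
    ∀ {σ : ZMod n ≃ V}, Good k R a σ →
      Good k R a ((Equiv.swap (p : ZMod n) ((p + m : ℕ) : ZMod n)).trans σ) := by
  induction m with
  | zero => intro σ hσ; simpa using hσ
  | succ m ih =>
    intro σ hσ
    have hadj : ∀ {σ : ZMod n ≃ V}, Good k R a σ →
      Good k R a ((Equiv.swap ((p + m : ℕ) : ZMod n) ((p + (m + 1) : ℕ) : ZMod n)).trans σ) := by
      intro σ hσ
      have e : ((p + (m + 1) : ℕ) : ZMod n) = ((p + m : ℕ) : ZMod n) + 1 := by push_cast; ring
      rw [e]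
      refine good_swap hk hn ht hσ (nat_ne (by omega) (by omega)) ?_
      rw [← e]
      exact nat_ne (by omega) (by omega)
    rcases Nat.eq_zero_or_pos m with rfl | hm
    · simpa using hadj hσ
    · have h3 := hadj (ih (by omega) (hadj hσ))
      have key := Equiv.swap_mul_swap_mul_swap (x := (p : ZMod n))
        (y := ((p + m : ℕ) : ZMod n)) (z := ((p + (m + 1) : ℕ) : ZMod n))
        (fun h => by have := nat_inj (by omega) (by omega) h; omega)
        (fun h => by have := nat_inj (by omega) (by omega) h; omega)
      rw [Equiv.swap_comm, ← key]
      exact h3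

theorem good_all {R : Set (Finset V)} {a : V} (hk : 2 ≤ k) (hn : 2 * k < n)
    (ht : ∀ σ : ZMod n ≃ V, ∃ c : ZMod n, ∀ x, arcS k σ x ∈ R ↔ ∃ i < k, x = c + (i : ZMod n))
    (σ' : ZMod n ≃ V) (hσ' : σ' 0 = a) :
    ∀ (N : ℕ) (σ : ZMod n ≃ V), Good k R a σ → #{p | σ p ≠ σ' p} ≤ N → Good k R a σ' := by
  intro N
  induction N with
  | zero =>
    intro σ hσ h
    have : σ = σ' := by
      ext p
      by_contra hne
      have : p ∈ ({p | σ p ≠ σ' p} : Finset (ZMod n)) := by simpa using hne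
      have := card_pos.2 ⟨p, this⟩
      omega
    exact this ▸ hσ
  | succ N ih =>
    intro σ hσ h
    by_cases hex : ∃ p, σ p ≠ σ' p
    · obtain ⟨p, hp⟩ := hex
      set q := σ.symm (σ' p) with hq
      have hσq : σ q = σ' p := by simp [hq]
      have hp0 : p ≠ 0 := by rintro rfl; exact hp (by rw [hσ.1, hσ'])
      have hpq : p ≠ q := by intro h; apply hp; rw [← hσq, ← h]
      have hq0 : q ≠ 0 := by
        intro h
        rw [h, hσ.1, ← hσ'] at hσq
        exact hp0 (σ'.injective hσq).symm
      have hgood : Good k R a ((Equiv.swap p q).trans σ) := by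
        have hpv := ZMod.natCast_zmod_val p
        have hqv := ZMod.natCast_zmod_val q
        have hp1 : p.val ≠ 0 := by simpa using hp0
        have hq1 : q.val ≠ 0 := by simpa using hq0
        have hp2 := ZMod.val_lt p
        have hq2 := ZMod.val_lt q
        rcases le_total p.val q.val with h | h
        · obtain ⟨m, hm⟩ := Nat.exists_eq_add_of_le h
          have := good_swap_nat hk hn ht p.val m (by omega) (by omega) hσ
          rwa [← hm, hpv, hqv] at this
        · obtain ⟨m, hm⟩ := Nat.exists_eq_add_of_le h
          have := good_swap_nat hk hn ht q.val m (by omega) (by omega) hσ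
          rwa [← hm, hpv, hqv, Equiv.swap_comm] at this
      refine ih _ hgood ?_
      have hlt : #{x | ((Equiv.swap p q).trans σ) x ≠ σ' x} < #{x | σ x ≠ σ' x} := by
        apply card_lt_card
        rw [ssubset_iff_of_subset]
        · refine ⟨p, by simpa using hp, ?_⟩
          intro h
          exact (mem_filter.1 h).2 (by simp [hσq])
        · intro x hx
          refine mem_filter.2 ⟨mem_univ _, ?_⟩
          replace hx : σ (Equiv.swap p q x) ≠ σ' x := (mem_filter.1 hx).2
          rw [Equiv.swap_apply_def] at hx
          split_ifs at hx with h1 h2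
          · rw [h1]; exact hp
          · rw [h2, hσq]
            exact fun h => hpq (σ'.injective h)
          · exact hx
      omega
    · push Not at hex
      have : σ = σ' := Equiv.ext hex
      exact this ▸ hσ

theorem set_star (hV : Fintype.card V = n) (hk : 2 ≤ k) (hn : 2 * k < n) (R : Set (Finset V))
    (hint : ∀ A ∈ R, ∀ B ∈ R, ∃ v, v ∈ A ∧ v ∈ B) (hcard : ∀ A ∈ R, #A = k)
    (ht : ∀ (σ : ZMod n ≃ V) (X : Finset (ZMod n)), (∀ x, x ∈ X ↔ arcS k σ x ∈ R) → #X = k) :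
    ∃ a, ∀ A, A ∈ R ↔ #A = k ∧ a ∈ A := by
  classical
  have ht' : ∀ σ : ZMod n ≃ V, ∃ c : ZMod n, ∀ x,
      arcS k σ x ∈ R ↔ ∃ i < k, x = c + (i : ZMod n) := by
    intro σ
    have hX := ht σ {x | arcS k σ x ∈ R} (by simp)
    obtain ⟨c, hc⟩ := circle_tight (by omega) hn _ (by
      intro x hx y hy
      simp only [mem_filter, mem_univ, true_and] at hx hy
      obtain ⟨v, h1, h2⟩ := hint _ hx _ hy
      exact near_of_arcS h1 h2) hX
    exact ⟨c, fun x => by rw [← hc]; simp⟩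
  obtain ⟨σ0⟩ : Nonempty (ZMod n ≃ V) :=
    Fintype.card_eq.1 (by rw [ZMod.card, hV])
  obtain ⟨c, hc⟩ := ht' σ0
  set σ1 : ZMod n ≃ V := (Equiv.addRight (c + ((k - 1 : ℕ) : ZMod n))).trans σ0 with hσ1
  have hg : Good k R (σ1 0) σ1 := by
    refine ⟨rfl, fun x => ?_⟩
    have : arcS k σ1 x = arcS k σ0 (x + (c + ((k - 1 : ℕ) : ZMod n))) := by
      simp only [arcS, hσ1, Equiv.trans_apply, Equiv.coe_addRight]
      congr 1
      funext i
      congr 1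
      ring
    rw [this, hc]
    constructor
    · rintro ⟨i, hi, h⟩
      refine ⟨k - 1 - i, by omega, ?_⟩
      rw [Nat.cast_sub (by omega)]
      linear_combination h
    · rintro ⟨i, hi, h⟩
      refine ⟨k - 1 - i, by omega, ?_⟩
      rw [Nat.cast_sub (show i ≤ k - 1 by omega)]
      linear_combination h
  set a := σ1 0 with ha
  have hall : ∀ σ' : ZMod n ≃ V, σ' 0 = a → Good k R a σ' :=
    fun σ' h => good_all hk hn ht' σ' h _ σ1 hg le_rfl
  have hmem : ∀ A : Finset V, #A = k → a ∈ A → A ∈ R := by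
    intro A hA haA
    haveI : NeZero k := ⟨by omega⟩
    obtain ⟨e⟩ : Nonempty (ZMod k ≃ A) := Fintype.card_eq.1 (by
      rw [ZMod.card, Fintype.card_coe, hA])
    set f : ZMod k → V := fun i => ((Equiv.swap 0 (e.symm ⟨a, haA⟩)).trans e i : V) with hf
    have hfi : f.Injective := Subtype.val_injective.comp (Equiv.injective _)
    obtain ⟨σ, hσ⟩ := exists_ext hV (lab_inj (show k ≤ n by omega)) hfi
    have hσ0 : σ 0 = a := by
      have := congrFun hσ 0
      simpa [lab, hf] using this
    have hA' : arcS k σ 0 = A := by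
      apply eq_of_subset_of_card_le
      · intro v hv
        simp only [arcS, mem_image, mem_range, zero_add] at hv
        obtain ⟨i, hi, rfl⟩ := hv
        have := congrFun hσ (i : ZMod k)
        simp only [Function.comp, lab, ZMod.val_natCast_of_lt hi] at this
        rw [this, hf]
        exact Subtype.property _
      · rw [card_arcS (by omega), hA]
    rw [← hA', (hall σ hσ0).2]
    exact ⟨0, by omega, by simp⟩
  refine ⟨a, fun A => ⟨fun hA => ⟨hcard A hA, ?_⟩, fun h => hmem A h.1 h.2⟩⟩
  by_contra haA
  obtain ⟨B, hB1, hB2, hB3⟩ := Finset.exists_subsuperset_card_eq (s := {a}) (t := Aᶜ) (n := k)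
    (by simpa using haA) (by simp; omega) (by rw [card_compl, hV, hcard A hA]; omega)
  obtain ⟨v, h1, h2⟩ := hint _ hA _ (hmem B hB3 (hB1 (by simp)))
  exact (mem_compl.1 (hB2 h2)) h1

end setstar
end BC

namespace BC
open Finset

theorem fst_cyc {W : Type*} [DecidableEq W] {k : ℕ} [NeZero k] (ρ γ : ZMod k → W) :
    (cyc ρ γ).image Prod.fst = univ.image ρ := by
  simp [cyc, image_union, image_image, Function.comp_def]

theorem snd_cyc {W : Type*} [DecidableEq W] {k : ℕ} [NeZero k] (ρ γ : ZMod k → W) :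
    (cyc ρ γ).image Prod.snd = univ.image γ := by
  rw [cyc, image_union, image_image, image_image]
  ext v
  simp only [mem_union, mem_image, mem_univ, true_and, Function.comp]
  constructor
  · rintro (⟨i, rfl⟩ | ⟨i, rfl⟩)
    exacts [⟨i, rfl⟩, ⟨i + 1, rfl⟩]
  · rintro ⟨i, rfl⟩
    exact Or.inl ⟨i, rfl⟩

/-- A local configuration of translated cycles for which the Katona bound holds. -/
structure Loc (n k : ℕ) [NeZero n] [NeZero k] (Q : Type) [Fintype Q] [DecidableEq Q]
    (ρ γ : Q → ZMod k → ZMod n) : Prop where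
  hρ : ∀ q, (ρ q).Injective
  hγ : ∀ q, (γ q).Injective
  rρ : ∀ q i, ∃ j : ℕ, j < k ∧ ρ q i = (j : ZMod n)
  rγ : ∀ q i, ∃ j : ℕ, j < k ∧ γ q i = (j : ZMod n)
  bd : ∀ F : Finset (ZMod n × ZMod n × Q),
    (∀ f ∈ F, ∀ g ∈ F, ∃ c, c ∈ cyc (fun i => f.1 + ρ f.2.2 i) (fun i => f.2.1 + γ f.2.2 i) ∧
      c ∈ cyc (fun i => g.1 + ρ g.2.2 i) (fun i => g.2.1 + γ g.2.2 i)) →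
    #F ≤ 2 * k * Fintype.card Q ∧ (2 * k < n → #F = 2 * k * Fintype.card Q →
      k * k ≤ #(F.image (fun f => (f.1, f.2.1))))

section
variable {n k : ℕ} [NeZero k] [NeZero n] {V : Type*} [Fintype V] [DecidableEq V]

theorem arc_of_range (hkn : k ≤ n) {ρ : ZMod k → ZMod n} (hρ : ρ.Injective)
    (r : ∀ i, ∃ j : ℕ, j < k ∧ ρ i = (j : ZMod n)) (σ : ZMod n ≃ V) (x : ZMod n) :
    univ.image (σ ∘ fun i => x + ρ i) = arcS k σ x := by
  apply eq_of_subset_of_card_le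
  · intro v hv
    simp only [mem_image, mem_univ, true_and, Function.comp] at hv
    obtain ⟨i, rfl⟩ := hv
    obtain ⟨j, hj, h⟩ := r i
    rw [h]
    simp only [arcS, mem_image, mem_range]
    exact ⟨j, hj, rfl⟩
  · rw [card_arcS hkn, card_image_of_injective _ (σ.injective.comp
      (show (fun i => x + ρ i).Injective from (add_right_injective x).comp hρ)), card_univ, ZMod.card]

theorem exists_arc (hV : Fintype.card V = n) (hkn : k ≤ n) (A : Finset V) (hA : #A = k) :
    ∃ σ : ZMod n ≃ V, arcS k σ 0 = A := by
  obtain ⟨e⟩ : Nonempty (ZMod k ≃ A) := Fintype.card_eq.1 (by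
      rw [ZMod.card, Fintype.card_coe, hA])
  obtain ⟨σ, hσ⟩ := exists_ext hV (lab_inj hkn) (Subtype.val_injective.comp e.injective)
  refine ⟨σ, ?_⟩
  apply eq_of_subset_of_card_le
  · intro v hv
    simp only [arcS, mem_image, mem_range, zero_add] at hv
    obtain ⟨i, hi, rfl⟩ := hv
    have := congrFun hσ (i : ZMod k)
    simp only [Function.comp, lab, ZMod.val_natCast_of_lt hi] at this
    rw [this]
    exact Subtype.property _
  · rw [card_arcS hkn, hA]

theorem exists_other (hV : Fintype.card V = n) (hk : 2 ≤ k) (hn : 2 * k ≤ n) (A : Finset V)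
    (hA : #A = k) (a : V) :
    ∃ A' : Finset V, #A' = k ∧ a ∈ A' ∧ ∀ v ∈ A, v ∈ A' → v = a := by
  obtain ⟨B, hB1, hB2, hB3⟩ := Finset.exists_subsuperset_card_eq (s := {a}) (t := insert a Aᶜ)
    (n := k) (by simp) (by simp; omega) (by
      have h1 : #Aᶜ ≤ #(insert a Aᶜ) := card_le_card (subset_insert _ _)
      rw [card_compl, hV, hA] at h1; omega)
  refine ⟨B, hB3, hB1 (by simp), fun v hv hv' => ?_⟩
  have := hB2 hv'
  simp only [mem_insert, mem_compl] at this
  tauto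

theorem main_of_loc (hV : Fintype.card V = n) (hk : 2 ≤ k) (hn : 2 * k ≤ n)
    {Q : Type} [Fintype Q] [DecidableEq Q] [Nonempty Q] {ρ γ : Q → ZMod k → ZMod n}
    (L : Loc n k Q ρ γ)
    (S B : Finset (Finset (V × V))) (e : V × V)
    (hS : ∀ E, E ∈ S ↔ IsCyc k E ∧ e ∈ E) (hB : ∀ E ∈ B, IsCyc k E)
    (hint : ∀ E ∈ B, ∀ F ∈ B, ∃ c, c ∈ E ∧ c ∈ F) :
    #B ≤ #S ∧ (2 * k < n → #B = #S → ∃ e', ∀ E ∈ B, e' ∈ E) := by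
  have hkn : k ≤ n := by omega
  set ρ' : ZMod n × ZMod n × Q → ZMod k → ZMod n := fun f i => f.1 + ρ f.2.2 i with hρ'
  set γ' : ZMod n × ZMod n × Q → ZMod k → ZMod n := fun f i => f.2.1 + γ f.2.2 i with hγ'
  have hFint : ∀ σ τ : ZMod n ≃ V,
      ∀ f ∈ ({i | mv σ τ (cyc (ρ' i) (γ' i)) ∈ B} : Finset (ZMod n × ZMod n × Q)),
      ∀ g ∈ ({i | mv σ τ (cyc (ρ' i) (γ' i)) ∈ B} : Finset (ZMod n × ZMod n × Q)),
      ∃ c, c ∈ cyc (ρ' f) (γ' f) ∧ c ∈ cyc (ρ' g) (γ' g) := by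
    intro σ τ f hf g hg
    simp only [mem_filter, mem_univ, true_and] at hf hg
    obtain ⟨c, h1, h2⟩ := hint _ hf _ hg
    simp only [mv, mem_image] at h1 h2
    obtain ⟨c1, h1, rfl⟩ := h1
    obtain ⟨c2, h2, h3⟩ := h2
    have := (σ.injective.prodMap τ.injective) h3
    subst this
    exact ⟨_, h1, h2⟩
  have hcI : Fintype.card (ZMod n × ZMod n × Q) = n * n * Fintype.card Q := by
    simp [Fintype.card_prod, ZMod.card]; ring
  have K := katona hV hk hkn S B e hS hB (I := ZMod n × ZMod n × Q) (ρ := ρ') (γ := γ')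
    (fun f => (add_right_injective _).comp (L.hρ _))
    (fun f => (add_right_injective _).comp (L.hγ _)) (by
      intro σ τ
      have := (L.bd _ (hFint σ τ)).1
      rw [hcI]
      calc _ ≤ n * n * (2 * k * Fintype.card Q) := Nat.mul_le_mul_left _ this
        _ = _ := by ring)
  refine ⟨K.1, fun hlt hcard => ?_⟩
  have hn0 : 0 < n * n := by have := NeZero.pos n; positivity
  set R : Set (Finset V) := {A | ∃ E ∈ B, A = E.image Prod.fst} with hR
  set C : Set (Finset V) := {A | ∃ E ∈ B, A = E.image Prod.snd} with hC
  have hRi : ∀ A ∈ R, ∀ A' ∈ R, ∃ v, v ∈ A ∧ v ∈ A' := by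
    rintro _ ⟨E, hE, rfl⟩ _ ⟨F, hF, rfl⟩
    obtain ⟨c, h1, h2⟩ := hint _ hE _ hF
    exact ⟨c.1, mem_image_of_mem _ h1, mem_image_of_mem _ h2⟩
  have hCi : ∀ A ∈ C, ∀ A' ∈ C, ∃ v, v ∈ A ∧ v ∈ A' := by
    rintro _ ⟨E, hE, rfl⟩ _ ⟨F, hF, rfl⟩
    obtain ⟨c, h1, h2⟩ := hint _ hE _ hF
    exact ⟨c.2, mem_image_of_mem _ h1, mem_image_of_mem _ h2⟩
  have hRc : ∀ A ∈ R, #A = k := by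
    rintro _ ⟨E, hE, rfl⟩
    obtain ⟨r, c, hr, hc, rfl⟩ := hB E hE
    rw [fst_cyc, card_image_of_injective _ hr, card_univ, ZMod.card]
  have hCc : ∀ A ∈ C, #A = k := by
    rintro _ ⟨E, hE, rfl⟩
    obtain ⟨r, c, hr, hc, rfl⟩ := hB E hE
    rw [snd_cyc, card_image_of_injective _ hc, card_univ, ZMod.card]
  have hfst : ∀ (σ τ : ZMod n ≃ V) f, (mv σ τ (cyc (ρ' f) (γ' f))).image Prod.fst
      = arcS k σ f.1 := by
    intro σ τ f
    rw [mv_cyc, fst_cyc]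
    exact arc_of_range hkn (L.hρ _) (L.rρ _) σ f.1
  have hsnd : ∀ (σ τ : ZMod n ≃ V) f, (mv σ τ (cyc (ρ' f) (γ' f))).image Prod.snd
      = arcS k τ f.2.1 := by
    intro σ τ f
    rw [mv_cyc, snd_cyc]
    exact arc_of_range hkn (L.hγ _) (L.rγ _) τ f.2.1
  have hXY : ∀ (σ τ : ZMod n ≃ V) (X Y : Finset (ZMod n)), (∀ x, x ∈ X ↔ arcS k σ x ∈ R) →
      (∀ x, x ∈ Y ↔ arcS k τ x ∈ C) → #X = k ∧ #Y = k ∧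
      ∀ x y, arcS k σ x ∈ R → arcS k τ y ∈ C →
        ∃ E ∈ B, E.image Prod.fst = arcS k σ x ∧ E.image Prod.snd = arcS k τ y := by
    intro σ τ X Y hX hY
    have hF := K.2 hcard σ τ
    rw [hcI] at hF
    have hP := (L.bd _ (hFint σ τ)).2 hlt (by
      apply Nat.eq_of_mul_eq_mul_left hn0
      rw [hF]; ring)
    have hX1 : #X ≤ k := (circle_bound hn X (by
      intro x hx y hy
      obtain ⟨v, h1, h2⟩ := hRi _ ((hX x).1 hx) _ ((hX y).1 hy)
      exact near_of_arcS h1 h2)).1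
    have hY1 : #Y ≤ k := (circle_bound hn Y (by
      intro x hx y hy
      obtain ⟨v, h1, h2⟩ := hCi _ ((hY x).1 hx) _ ((hY y).1 hy)
      exact near_of_arcS h1 h2)).1
    have hsub : image (fun f => (f.1, f.2.1))
        ({i | mv σ τ (cyc (ρ' i) (γ' i)) ∈ B} : Finset (ZMod n × ZMod n × Q)) ⊆ X ×ˢ Y := by
      intro p hp
      simp only [mem_image, mem_filter, mem_univ, true_and] at hp
      obtain ⟨f, hf, rfl⟩ := hp
      rw [mem_product, hX, hY]
      exact ⟨⟨_, hf, (hfst σ τ f).symm⟩, ⟨_, hf, (hsnd σ τ f).symm⟩⟩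
    have h1 := card_le_card hsub
    rw [card_product] at h1
    have hk0 : 0 < k := by omega
    have hXk : #X = k := by
      apply le_antisymm hX1
      by_contra h
      have : #X * #Y < k * k := by nlinarith
      omega
    have hYk : #Y = k := by
      apply le_antisymm hY1
      by_contra h
      have : #X * #Y < k * k := by nlinarith
      omega
    have heq := eq_of_subset_of_card_le hsub (by rw [card_product, hXk, hYk]; exact hP)
    refine ⟨hXk, hYk, fun x y hx hy => ?_⟩
    have hm : (x, y) ∈ X ×ˢ Y := by rw [mem_product, hX, hY]; exact ⟨hx, hy⟩
    rw [← heq] at hm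
    simp only [mem_image, mem_filter, mem_univ, true_and] at hm
    obtain ⟨f, hf, hfe⟩ := hm
    have e1 := congrArg Prod.fst hfe
    have e2 := congrArg Prod.snd hfe
    simp only at e1 e2
    exact ⟨_, hf, by rw [hfst, e1], by rw [hsnd, e2]⟩
  classical
  obtain ⟨σ0⟩ : Nonempty (ZMod n ≃ V) := Fintype.card_eq.1 (by rw [ZMod.card, hV])
  obtain ⟨a, ha⟩ := set_star hV hk hlt R hRi hRc (fun σ X hX =>
    (hXY σ σ0 X {y | arcS k σ0 y ∈ C} hX (by simp)).1)
  obtain ⟨b, hb⟩ := set_star hV hk hlt C hCi hCc (fun τ Y hY =>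
    (hXY σ0 τ {y | arcS k σ0 y ∈ R} Y (by simp) hY).2.1)
  refine ⟨(a, b), fun E hE => ?_⟩
  obtain ⟨A', hA1, hA2, hA3⟩ := exists_other hV hk hn (E.image Prod.fst)
    (hRc _ ⟨E, hE, rfl⟩) a
  obtain ⟨B', hB1, hB2, hB3⟩ := exists_other hV hk hn (E.image Prod.snd)
    (hCc _ ⟨E, hE, rfl⟩) b
  obtain ⟨σ, hσ⟩ := exists_arc hV hkn A' hA1
  obtain ⟨τ, hτ⟩ := exists_arc hV hkn B' hB1
  obtain ⟨E', hE', h1, h2⟩ := (hXY σ τ {y | arcS k σ y ∈ R} {y | arcS k τ y ∈ C} (by simp)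
    (by simp)).2.2 0 0 (by rw [hσ, ha]; exact ⟨hA1, hA2⟩) (by rw [hτ, hb]; exact ⟨hB1, hB2⟩)
  obtain ⟨c, hc, hc'⟩ := hint _ hE _ hE'
  have e1 := hA3 c.1 (mem_image_of_mem _ hc) (by
    rw [← hσ, ← h1]; exact mem_image_of_mem _ hc')
  have e2 := hB3 c.2 (mem_image_of_mem _ hc) (by
    rw [← hτ, ← h2]; exact mem_image_of_mem _ hc')
  have : c = (a, b) := Prod.ext e1 e2
  exact this ▸ hc

end

/-- near-ness of the projections of an intersecting family of translated cycles -/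
theorem near_of_meet {n k : ℕ} [NeZero k] {ρ γ ρ' γ' : ZMod k → ZMod n}
    (rρ : ∀ i, ∃ j : ℕ, j < k ∧ ρ i = (j : ZMod n)) (rγ : ∀ i, ∃ j : ℕ, j < k ∧ γ i = (j : ZMod n))
    (rρ' : ∀ i, ∃ j : ℕ, j < k ∧ ρ' i = (j : ZMod n))
    (rγ' : ∀ i, ∃ j : ℕ, j < k ∧ γ' i = (j : ZMod n)) {x y x' y' : ZMod n}
    (h : ∃ c, c ∈ cyc (fun i => x + ρ i) (fun i => y + γ i) ∧
      c ∈ cyc (fun i => x' + ρ' i) (fun i => y' + γ' i)) : Near n k x x' ∧ Near n k y y' := by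
  obtain ⟨c, h1, h2⟩ := h
  constructor
  · have h1 := mem_image_of_mem Prod.fst h1
    have h2 := mem_image_of_mem Prod.fst h2
    rw [fst_cyc] at h1 h2
    simp only [mem_image, mem_univ, true_and] at h1 h2
    obtain ⟨i, h1⟩ := h1
    obtain ⟨i', h2⟩ := h2
    obtain ⟨j, hj, e⟩ := rρ i
    obtain ⟨j', hj', e'⟩ := rρ' i'
    exact ⟨j, hj, j', hj', by rw [← e, ← e', h1, h2]⟩
  · have h1 := mem_image_of_mem Prod.snd h1
    have h2 := mem_image_of_mem Prod.snd h2
    rw [snd_cyc] at h1 h2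
    simp only [mem_image, mem_univ, true_and] at h1 h2
    obtain ⟨i, h1⟩ := h1
    obtain ⟨i', h2⟩ := h2
    obtain ⟨j, hj, e⟩ := rγ i
    obtain ⟨j', hj', e'⟩ := rγ' i'
    exact ⟨j, hj, j', hj', by rw [← e, ← e', h1, h2]⟩

theorem small_diff {k : ℕ} [NeZero k] (hk : k = 2 ∨ 4 ≤ k) (D : Finset (ZMod k))
    (hD : ∀ a ∈ D, ∀ b ∈ D, a = b ∨ a = b + 1 ∨ b = a + 1) : #D ≤ 2 := by
  rcases hk with rfl | hk
  · exact (card_le_univ D).trans (by simp [ZMod.card])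
  · rcases D.eq_empty_or_nonempty with rfl | ⟨a, ha⟩
    · simp
    by_cases hm : a - 1 ∈ D
    · refine (card_le_card (show D ⊆ {a, a - 1} from ?_)).trans card_le_two
      intro b hb
      simp only [mem_insert, mem_singleton]
      rcases hD a ha b hb with h | h | h
      · exact Or.inl h.symm
      · right; rw [h]; ring
      · exfalso
        rcases hD _ hm b hb with h' | h' | h'
        · exact nat_ne (n := k) (a := 2) (by omega) (by omega) (by
            push_cast; linear_combination - h' - h)
        · exact nat_ne (n := k) (a := 3) (by omega) (by omega) (by
            push_cast; linear_combination - h' - h)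
        · exact nat_ne (n := k) (a := 1) (by omega) (by omega) (by
            push_cast; linear_combination h' - h)
    · refine (card_le_card (show D ⊆ {a, a + 1} from ?_)).trans card_le_two
      intro b hb
      simp only [mem_insert, mem_singleton]
      rcases hD a ha b hb with h | h | h
      · exact Or.inl h.symm
      · exfalso; apply hm; rw [h]; simpa using hb
      · exact Or.inr h

theorem loc_fib {n k : ℕ} [NeZero n] [NeZero k] (hk : k = 2 ∨ 4 ≤ k) (hn : 2 * k ≤ n)
    (F : Finset (ZMod n × ZMod n × ZMod k))
    (hF : ∀ f ∈ F, ∀ g ∈ F, ∃ c,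
      c ∈ cyc (fun i => f.1 + lab n k i) (fun i => f.2.1 + lab n k (i + f.2.2)) ∧
      c ∈ cyc (fun i => g.1 + lab n k i) (fun i => g.2.1 + lab n k (i + g.2.2))) :
    #F ≤ 2 * #(F.image (fun f => (f.1, f.2.1))) := by
  refine card_le_mul_card_image F 2 (fun p _ => ?_)
  rw [← card_image_of_injOn (f := fun f : ZMod n × ZMod n × ZMod k => f.2.2)]
  · apply small_diff hk
    intro a ha b hb
    simp only [mem_image, mem_filter] at ha hb
    obtain ⟨⟨x, y, a⟩, ⟨hf, hfp⟩, rfl⟩ := ha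
    obtain ⟨⟨x', y', b⟩, ⟨hg, hgp⟩, rfl⟩ := hb
    rw [← hgp, Prod.mk.injEq] at hfp
    obtain ⟨c, h1, h2⟩ := hF _ hf _ hg
    simp only at hfp
    obtain ⟨rfl, rfl⟩ := hfp
    simp only [cyc, mem_union, mem_image, mem_univ, true_and] at h1 h2
    have hl := lab_inj (n := n) (k := k) (by omega)
    rcases h1 with ⟨i, rfl⟩ | ⟨i, rfl⟩ <;> rcases h2 with ⟨j, h⟩ | ⟨j, h⟩ <;>
      rw [Prod.mk.injEq] at h <;>
      have e1 := hl (add_left_cancel h.1) <;> have e2 := hl (add_left_cancel h.2) <;>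
      simp only at e1 e2 ⊢ <;> subst e1
    · left; linear_combination -e2
    · right; left; linear_combination -e2
    · right; right; linear_combination e2
    · left; linear_combination -e2
  · intro f hf g hg h
    simp only [coe_filter, Set.mem_setOf_eq] at hf hg
    have := hf.2.trans hg.2.symm
    rw [Prod.mk.injEq] at this
    exact Prod.ext this.1 (Prod.ext this.2 h)

theorem lab_range (n k : ℕ) [NeZero k] (i : ZMod k) : ∃ j : ℕ, j < k ∧ lab n k i = (j : ZMod n) :=
  ⟨i.val, ZMod.val_lt _, rfl⟩

theorem loc_gen {n k : ℕ} [NeZero n] [NeZero k] (hk : k = 2 ∨ 4 ≤ k) (hn : 2 * k ≤ n) :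
    Loc n k (ZMod k) (fun _ i => lab n k i) (fun d i => lab n k (i + d)) where
  hρ := fun _ => lab_inj (by omega)
  hγ := fun d => (lab_inj (by omega)).comp (add_left_injective d)
  rρ := fun _ i => lab_range n k i
  rγ := fun d i => lab_range n k (i + d)
  bd := by
    intro F hF
    have hnear : ∀ f ∈ F, ∀ g ∈ F, Near n k f.1 g.1 ∧ Near n k f.2.1 g.2.1 := fun f hf g hg =>
      near_of_meet (fun i => lab_range n k i)
        (fun i => lab_range n k (i + f.2.2)) (fun i => lab_range n k i)
        (fun i => lab_range n k (i + g.2.2)) (hF f hf g hg)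
    have hX := (circle_bound hn (F.image fun f => f.1) (by
      intro x hx y hy
      simp only [mem_image] at hx hy
      obtain ⟨f, hf, rfl⟩ := hx
      obtain ⟨g, hg, rfl⟩ := hy
      exact (hnear f hf g hg).1)).1
    have hY := (circle_bound hn (F.image fun f => f.2.1) (by
      intro x hx y hy
      simp only [mem_image] at hx hy
      obtain ⟨f, hf, rfl⟩ := hx
      obtain ⟨g, hg, rfl⟩ := hy
      exact (hnear f hf g hg).2)).1
    have hP : #(F.image (fun f => (f.1, f.2.1))) ≤ k * k := by
      refine (card_le_card (t := (F.image fun f => f.1) ×ˢ (F.image fun f => f.2.1)) ?_).trans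
        (by rw [card_product]; exact Nat.mul_le_mul hX hY)
      intro p hp
      simp only [mem_image] at hp
      obtain ⟨f, hf, rfl⟩ := hp
      rw [mem_product]
      exact ⟨mem_image_of_mem (fun f : ZMod n × ZMod n × ZMod k => f.1) hf,
        mem_image_of_mem (fun f : ZMod n × ZMod n × ZMod k => f.2.1) hf⟩
    have hFP := loc_fib hk hn F hF
    rw [ZMod.card]
    refine ⟨by nlinarith, fun _ h => by nlinarith⟩

end BC

namespace BC
open Finset

/-- permutations of three letters -/
def pT (q : Fin 6) (i : Fin 3) : Fin 3 :=
  (![![0, 1, 2], ![0, 2, 1], ![1, 0, 2], ![1, 2, 0], ![2, 0, 1], ![2, 1, 0]] : Fin 6 → Fin 3 → Fin 3) q i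

/-- local vertices: two offsets and a permutation -/
abbrev LV := Fin 3 × Fin 3 × Fin 6

/-- two local cycles meet -/
def meetL (u v : LV) : Prop :=
  ∃ i i' j j' : Fin 3, j ≠ pT u.2.2 i ∧ j' ≠ pT v.2.2 i' ∧
    u.1.val + i.val = v.1.val + i'.val ∧ u.2.1.val + j.val = v.2.1.val + j'.val

instance (u v : LV) : Decidable (meetL u v) := by unfold meetL; infer_instance

/-- the cell `(2,2)` belongs to the local cycle -/
def starL (u : LV) : Prop := pT u.2.2 (Fin.rev u.1) ≠ Fin.rev u.2.1

instance (u : LV) : Decidable (starL u) := by unfold starL; infer_instance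

/-- read a table of local vertices -/
def rd (t : List ℕ) (u : LV) : LV :=
  let a := t.getD (u.1.val * 18 + u.2.1.val * 6 + u.2.2.val) 0
  (Fin.ofNat 3 (a / 18), Fin.ofNat 3 (a / 6), Fin.ofNat 6 a)

/-- matching of the non-star vertices into the star -/
def mT : LV → LV := rd
  [42, 0, 53, 0, 0, 0, 0, 38, 0, 0, 51, 0, 0, 0, 0, 22, 0, 46, 0, 52, 0, 11, 0, 0, 50, 0, 0, 0, 0,
   39, 0, 0, 37, 0, 47, 0, 0, 0, 0, 0, 13, 14, 0, 0, 4, 35, 0, 0, 20, 6, 0, 0, 0, 0]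

/-- a further neighbour in the star -/
def mT2 : LV → LV := rd
  [26, 0, 30, 0, 0, 0, 0, 30, 0, 0, 23, 0, 0, 0, 0, 23, 0, 23, 0, 16, 0, 16, 0, 0, 1, 0, 0, 0, 0,
   16, 0, 0, 1, 0, 1, 0, 0, 0, 0, 0, 9, 9, 0, 0, 1, 1, 0, 0, 1, 1, 0, 0, 0, 0]

/-- inverse of the matching -/
def mI : LV → LV := rd
  [0, 0, 0, 0, 44, 0, 49, 0, 0, 0, 0, 21, 0, 40, 41, 0, 0, 0, 0, 0, 48, 0, 15, 0, 0, 0, 0, 0, 0, 0,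
   0, 0, 0, 0, 0, 45, 0, 32, 7, 29, 0, 0, 0, 0, 0, 0, 17, 34, 0, 0, 24, 10, 19, 2]

theorem tab_check : ∀ v : LV, ¬ starL v →
    starL (mT v) ∧ ¬ meetL v (mT v) ∧ mI (mT v) = v ∧
    starL (mT2 v) ∧ ¬ meetL v (mT2 v) ∧ mT (mI (mT2 v)) ≠ mT2 v := by
  decide +kernel

theorem star_card : #{v : LV | starL v} = 36 := by decide +kernel

theorem star_proj : ∀ x y : Fin 3, ∃ p : Fin 6, starL (x, y, p) := by decide +kernel

theorem local_bound (F : Finset LV) (hF : ∀ u ∈ F, ∀ v ∈ F, meetL u v) :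
    #F ≤ 36 ∧ (#F = 36 → 9 ≤ #(F.image (fun f => (f.1, f.2.1)))) := by
  set φ : LV → LV := fun v => if starL v then v else mT v with hφ
  have hinj : Set.InjOn φ F := by
    intro v hv w hw h
    simp only [hφ] at h
    split_ifs at h with h1 h2 h2
    · exact h
    · exact absurd (hF w hw v hv) (h ▸ (tab_check w h2).2.1)
    · exact absurd (hF v hv w hw) (h ▸ (tab_check v h1).2.1)
    · rw [← (tab_check v h1).2.2.1, ← (tab_check w h2).2.2.1, h]
  have hmap : ∀ v ∈ F, φ v ∈ ({v : LV | starL v} : Finset LV) := by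
    intro v hv
    simp only [mem_filter, mem_univ, true_and, hφ]
    split_ifs with h
    · exact h
    · exact (tab_check v h).1
  have hle := card_le_card_of_injOn φ hmap hinj
  rw [star_card] at hle
  refine ⟨hle, fun h36 => ?_⟩
  have hsub : F ⊆ ({v : LV | starL v} : Finset LV) := by
    intro v hv
    simp only [mem_filter, mem_univ, true_and]
    by_contra hns
    obtain ⟨-, -, -, c1, c2, c3⟩ := tab_check v hns
    have hmap' : ∀ w ∈ F, φ w ∈ ({v : LV | starL v} : Finset LV).erase (mT2 v) := by
      intro w hw
      rw [mem_erase]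
      refine ⟨?_, hmap w hw⟩
      simp only [hφ]
      split_ifs with h
      · rintro rfl
        exact c2 (hF v hv _ hw)
      · intro h'
        rw [← h', (tab_check w h).2.2.1] at c3
        exact c3 rfl
    have := card_le_card_of_injOn φ hmap' hinj
    rw [card_erase_of_mem (by simpa using c1), star_card] at this
    omega
  have heq := eq_of_subset_of_card_le hsub (by rw [star_card, h36])
  have : (univ : Finset (Fin 3 × Fin 3)) ⊆ F.image (fun f => (f.1, f.2.1)) := by
    rintro ⟨x, y⟩ -
    obtain ⟨p, hp⟩ := star_proj x y
    rw [mem_image]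
    exact ⟨(x, y, p), by rw [heq]; simpa using hp, rfl⟩
  simpa using card_le_card this

theorem box {n : ℕ} (hn : 7 ≤ n) (X : Finset (ZMod n))
    (hX : ∀ x ∈ X, ∀ y ∈ X, Near n 3 x y) :
    ∃ c : ZMod n, ∀ x ∈ X, ∃ a : Fin 3, x = c + (a.val : ZMod n) := by
  by_cases h2 : ∃ x ∈ X, ∃ y ∈ X, y = x + ((2 : ℕ) : ZMod n)
  · obtain ⟨x, hx, y, hy, hxy⟩ := h2
    refine ⟨x, fun z hz => ?_⟩
    obtain ⟨d, hd, h | h⟩ := near_iff (hX x hx z hz)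
    · exact ⟨⟨d, hd⟩, h⟩
    · rcases Nat.eq_zero_or_pos d with rfl | h0
      · exact ⟨0, by simpa using h.symm⟩
      · refine absurd (hX z hz y hy) (not_near (d := d + 2) (by omega) (by omega) z y ?_)
        rw [hxy, h]; push_cast; ring
  · rcases X.eq_empty_or_nonempty with rfl | ⟨x, hx⟩
    · exact ⟨0, by simp⟩
    · refine ⟨x - 1, fun z hz => ?_⟩
      obtain ⟨d, hd, h | h⟩ := near_iff (hX x hx z hz)
      · have : d ≠ 2 := by rintro rfl; exact h2 ⟨x, hx, z, hz, h⟩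
        refine ⟨⟨d + 1, by omega⟩, ?_⟩
        rw [h]; push_cast; ring
      · have : d ≠ 2 := by rintro rfl; exact h2 ⟨z, hz, x, hx, h⟩
        refine ⟨⟨1 - d, by omega⟩, ?_⟩
        rw [h, Nat.cast_sub (by omega)]; push_cast; ring

theorem pT_inj : ∀ q : Fin 6, ∀ i j : Fin 3, pT q i = pT q j → i = j := by decide +kernel

/-- column offsets -/
def g3 (n : ℕ) (q : Fin 6) (i : ZMod 3) : ZMod n :=
  ((pT q ((i + 1 : ZMod 3) : Fin 3)).val : ZMod n)

theorem mem_cyc3 {n : ℕ} {x y : ZMod n} {q : Fin 6} {c : ZMod n × ZMod n}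
    (h : c ∈ cyc (fun i => x + lab n 3 i) (fun i => y + g3 n q i)) :
    ∃ i j : Fin 3, j ≠ pT q i ∧ c = (x + (i.val : ZMod n), y + (j.val : ZMod n)) := by
  simp only [cyc, mem_union, mem_image, mem_univ, true_and] at h
  rcases h with ⟨i, rfl⟩ | ⟨i, rfl⟩
  · refine ⟨i, pT q (i + 1 : ZMod 3), fun h => ?_, rfl⟩
    have := pT_inj q _ _ h
    have : ∀ i : Fin 3, i + 1 ≠ i := by decide
    exact this i ‹_›
  · refine ⟨i, pT q (i + 1 + 1 : ZMod 3), fun h => ?_, rfl⟩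
    have := pT_inj q _ _ h
    have : ∀ i : Fin 3, i + 1 + 1 ≠ i := by decide
    exact this i ‹_›

theorem g3_inj {n : ℕ} (hn : 3 ≤ n) (q : Fin 6) : (g3 n q).Injective := by
  intro i j h
  have h1 := nat_inj (by omega) (by omega) h
  have h2 := pT_inj q _ _ (Fin.ext h1)
  exact add_right_cancel (show (i + 1 : ZMod 3) = j + 1 from h2)

theorem g3_range (n : ℕ) (q : Fin 6) (i : ZMod 3) : ∃ j : ℕ, j < 3 ∧ g3 n q i = (j : ZMod n) :=
  ⟨_, (pT q ((i + 1 : ZMod 3) : Fin 3)).isLt, rfl⟩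

theorem loc_three {n : ℕ} [NeZero n] (hn : 7 ≤ n) :
    Loc n 3 (Fin 6) (fun _ i => lab n 3 i) (fun q i => g3 n q i) where
  hρ := fun _ => lab_inj (by omega)
  hγ := fun q => g3_inj (by omega) q
  rρ := fun _ i => lab_range n 3 i
  rγ := fun q i => g3_range n q i
  bd := by
    intro F hF
    have hnear : ∀ f ∈ F, ∀ g ∈ F, Near n 3 f.1 g.1 ∧ Near n 3 f.2.1 g.2.1 := fun f hf g hg =>
      near_of_meet (fun i => lab_range n 3 i)
        (fun i => g3_range n f.2.2 i) (fun i => lab_range n 3 i)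
        (fun i => g3_range n g.2.2 i) (hF f hf g hg)
    obtain ⟨c, hc⟩ := box hn (F.image fun f => f.1) (by
      intro x hx y hy
      simp only [mem_image] at hx hy
      obtain ⟨f, hf, rfl⟩ := hx
      obtain ⟨g, hg, rfl⟩ := hy
      exact (hnear f hf g hg).1)
    obtain ⟨d, hd⟩ := box hn (F.image fun f => f.2.1) (by
      intro x hx y hy
      simp only [mem_image] at hx hy
      obtain ⟨f, hf, rfl⟩ := hx
      obtain ⟨g, hg, rfl⟩ := hy
      exact (hnear f hf g hg).2)
    set ψ : LV → ZMod n × ZMod n × Fin 6 :=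
      fun u => (c + (u.1.val : ZMod n), d + (u.2.1.val : ZMod n), u.2.2) with hψ
    have hψi : ψ.Injective := by
      rintro ⟨a, b, q⟩ ⟨a', b', q'⟩ h
      simp only [hψ, Prod.mk.injEq] at h
      obtain ⟨h1, h2, rfl⟩ := h
      have e1 := nat_inj (by omega) (by omega) (add_left_cancel h1)
      have e2 := nat_inj (by omega) (by omega) (add_left_cancel h2)
      rw [Fin.ext e1, Fin.ext e2]
    set G : Finset LV := {u | ψ u ∈ F} with hG
    have hFG : F = G.image ψ := by
      ext ⟨x, y, q⟩
      simp only [hG, mem_image, mem_filter, mem_univ, true_and]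
      constructor
      · intro h
        obtain ⟨a, rfl⟩ := hc x (mem_image_of_mem (fun f : ZMod n × ZMod n × Fin 6 => f.1) h)
        obtain ⟨b, rfl⟩ := hd y (mem_image_of_mem (fun f : ZMod n × ZMod n × Fin 6 => f.2.1) h)
        exact ⟨(a, b, q), h, rfl⟩
      · rintro ⟨u, hu, h⟩
        exact h ▸ hu
    have hGm : ∀ u ∈ G, ∀ v ∈ G, meetL u v := by
      intro u hu v hv
      simp only [hG, mem_filter, mem_univ, true_and] at hu hv
      obtain ⟨e, h1, h2⟩ := hF _ hu _ hv
      obtain ⟨i, j, hij, rfl⟩ := mem_cyc3 h1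
      obtain ⟨i', j', hij', h⟩ := mem_cyc3 h2
      rw [Prod.mk.injEq] at h
      obtain ⟨h3, h4⟩ := h
      refine ⟨i, i', j, j', hij, hij', ?_, ?_⟩
      · refine nat_inj (n := n) (by omega) (by omega) ?_
        simp only [hψ] at h3
        push_cast
        linear_combination h3
      · refine nat_inj (n := n) (by omega) (by omega) ?_
        simp only [hψ] at h4
        push_cast
        linear_combination h4
    have hb := local_bound G hGm
    have hcard : #F = #G := by rw [hFG, card_image_of_injective _ hψi]
    rw [Fintype.card_fin, hcard]
    refine ⟨hb.1, fun _ h => ?_⟩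
    have h9 := hb.2 h
    have himg : F.image (fun f => (f.1, f.2.1)) = (G.image (fun f => (f.1, f.2.1))).image
        (fun p : Fin 3 × Fin 3 => (c + (p.1.val : ZMod n), d + (p.2.val : ZMod n))) := by
      rw [hFG, image_image, image_image]
      rfl
    rw [himg, card_image_of_injective]
    · exact h9
    · rintro ⟨a, b⟩ ⟨a', b'⟩ h
      simp only [Prod.mk.injEq] at h
      obtain ⟨h1, h2⟩ := h
      have e1 := nat_inj (by omega) (by omega) (add_left_cancel h1)
      have e2 := nat_inj (by omega) (by omega) (add_left_cancel h2)
      rw [Fin.ext e1, Fin.ext e2]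

/-- rows of a decomposition of `K_{6,6}` into 6-cycles -/
def r6 (q : Fin 6) (i : ZMod 3) : ZMod 6 :=
  (![![0, 1, 2], ![0, 1, 3], ![0, 2, 3], ![1, 4, 5], ![2, 4, 5], ![3, 4, 5]] :
    Fin 6 → Fin 3 → Fin 6) q i

/-- columns of a decomposition of `K_{6,6}` into 6-cycles -/
def c6 (q : Fin 6) (i : ZMod 3) : ZMod 6 :=
  (![![0, 1, 2], ![2, 3, 0], ![4, 5, 1], ![4, 5, 0], ![3, 4, 1], ![5, 3, 2]] :
    Fin 6 → Fin 3 → Fin 6) q i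

theorem r6_inj : ∀ q : Fin 6, ∀ i j : ZMod 3, r6 q i = r6 q j → i = j := by decide +kernel
theorem c6_inj : ∀ q : Fin 6, ∀ i j : ZMod 3, c6 q i = c6 q j → i = j := by decide +kernel

theorem dis6 : ∀ q q' : Fin 6, ∀ i j : ZMod 3, r6 q i = r6 q' j →
    (c6 q i = c6 q' j ∨ c6 q i = c6 q' (j + 1) ∨ c6 q (i + 1) = c6 q' j ∨
      c6 q (i + 1) = c6 q' (j + 1)) → q = q' := by decide +kernel

theorem main_six {V : Type*} [Fintype V] [DecidableEq V] (hV : Fintype.card V = 6)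
    (S B : Finset (Finset (V × V))) (e : V × V)
    (hS : ∀ E, E ∈ S ↔ IsCyc 3 E ∧ e ∈ E) (hB : ∀ E ∈ B, IsCyc 3 E)
    (hint : ∀ E ∈ B, ∀ F ∈ B, ∃ c, c ∈ E ∧ c ∈ F) : #B ≤ #S := by
  refine (katona (n := 6) (k := 3) hV (by norm_num) (by norm_num) S B e hS hB (I := Fin 6)
    (ρ := r6) (γ := c6) (fun q i j h => r6_inj q i j h) (fun q i j h => c6_inj q i j h) ?_).1
  intro σ τ
  have : #{i : Fin 6 | mv σ τ (cyc (r6 i) (c6 i)) ∈ B} ≤ 1 := by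
    rw [card_le_one]
    intro f hf g hg
    simp only [mem_filter, mem_univ, true_and] at hf hg
    obtain ⟨c, h1, h2⟩ := hint _ hf _ hg
    simp only [mv, mem_image] at h1 h2
    obtain ⟨c1, h1, rfl⟩ := h1
    obtain ⟨c2, h2, h3⟩ := h2
    have := (σ.injective.prodMap τ.injective) h3
    subst this
    simp only [cyc, mem_union, mem_image, mem_univ, true_and] at h1 h2
    rcases h1 with ⟨i, rfl⟩ | ⟨i, rfl⟩ <;> rcases h2 with ⟨j, h⟩ | ⟨j, h⟩ <;>
      rw [Prod.mk.injEq] at h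
    · exact dis6 f g i j h.1.symm (Or.inl h.2.symm)
    · exact dis6 f g i j h.1.symm (Or.inr (Or.inl h.2.symm))
    · exact dis6 f g i j h.1.symm (Or.inr (Or.inr (Or.inl h.2.symm)))
    · exact dis6 f g i j h.1.symm (Or.inr (Or.inr (Or.inr h.2.symm)))
  rw [Fintype.card_fin]
  omega

/-- the Erdős–Ko–Rado statement in the cell model -/
theorem main_model {n k : ℕ} [NeZero k] {V : Type*} [Fintype V] [DecidableEq V]
    (hV : Fintype.card V = n) (hk : 2 ≤ k) (hn : 2 * k ≤ n)
    (S B : Finset (Finset (V × V))) (e : V × V)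
    (hS : ∀ E, E ∈ S ↔ IsCyc k E ∧ e ∈ E) (hB : ∀ E ∈ B, IsCyc k E)
    (hint : ∀ E ∈ B, ∀ F ∈ B, ∃ c, c ∈ E ∧ c ∈ F) :
    #B ≤ #S ∧ (2 * k < n → #B = #S → ∃ e', ∀ E ∈ B, e' ∈ E) := by
  haveI : NeZero n := ⟨by omega⟩
  by_cases h3 : k = 3
  · subst h3
    rcases hn.lt_or_eq with h | h
    · exact main_of_loc hV hk hn (loc_three (by omega)) S B e hS hB hint
    · exact ⟨main_six (by omega) S B e hS hB hint, fun h' => by omega⟩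
  · exact main_of_loc hV hk hn (loc_gen (by omega) hn) S B e hS hB hint

end BC

namespace BC
open Finset

/-- a cell as an edge -/
def emb {n : ℕ} (p : Fin n × Fin n) : Sym2 (Fin n ⊕ Fin n) := s(Sum.inl p.1, Sum.inr p.2)

theorem emb_inj {n : ℕ} : (emb (n := n)).Injective := by
  rintro ⟨a, b⟩ ⟨c, d⟩ h
  simp [emb, Sym2.eq_iff] at h
  simp [h]

theorem val_succ {k : ℕ} [NeZero k] (i : ZMod k) : (i + 1).val = (i.val + 1) % k := by
  rw [ZMod.val_add, ZMod.val_one_eq_one_mod, Nat.add_mod_mod]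

theorem forward_aux {n k : ℕ} [NeZero k] {v0 : Fin n}
    (w : (completeBipartiteGraph (Fin n) (Fin n)).Walk (Sum.inr v0) (Sum.inr v0))
    (hw : w.IsCycle) (hl : w.length = 2 * k) :
    ∃ C : Finset (Fin n × Fin n), IsCyc k C ∧ w.edges.toFinset = C.image emb := by
  have hk0 := NeZero.pos k
  have hpar : ∀ m, m < k → (∃ c, w.getVert (2 * m) = Sum.inr c) ∧
      ∃ r, w.getVert (2 * m + 1) = Sum.inl r := by
    have hstep : ∀ m, m < k → (∃ c, w.getVert (2 * m) = Sum.inr c) →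
      ∃ r, w.getVert (2 * m + 1) = Sum.inl r := by
      rintro m hm ⟨c, hc⟩
      have := w.adj_getVert_succ (i := 2 * m) (by omega)
      rw [hc] at this
      rcases hx : w.getVert (2 * m + 1) with r | r
      · exact ⟨r, rfl⟩
      · rw [hx] at this; simp at this
    intro m
    induction m with
    | zero => intro hm; exact ⟨⟨v0, by simp⟩, hstep 0 hm ⟨v0, by simp⟩⟩
    | succ m ih =>
      intro hm
      obtain ⟨-, r, hr⟩ := ih (by omega)
      have : ∃ c, w.getVert (2 * (m + 1)) = Sum.inr c := by
        have := w.adj_getVert_succ (i := 2 * m + 1) (by omega)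
        rw [hr] at this
        rcases hx : w.getVert (2 * m + 1 + 1) with r | r
        · rw [hx] at this; simp at this
        · exact ⟨r, by rw [← hx]⟩
      exact ⟨this, hstep _ hm this⟩
  choose γ hγ using fun i : ZMod k => (hpar i.val (ZMod.val_lt i)).1
  choose ρ hρ using fun i : ZMod k => (hpar i.val (ZMod.val_lt i)).2
  have hγ1 : ∀ i, w.getVert (2 * i.val + 1 + 1) = Sum.inr (γ (i + 1)) := by
    intro i
    rw [← hγ, val_succ]
    have := ZMod.val_lt i
    rcases Nat.lt_or_ge (i.val + 1) k with h | h
    · rw [Nat.mod_eq_of_lt h]; rfl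
    · have e : i.val + 1 = k := by omega
      rw [e, Nat.mod_self, show 2 * i.val + 1 + 1 = w.length by omega]
      simp
  refine ⟨cyc ρ γ, ⟨ρ, γ, ?_, ?_, rfl⟩, ?_⟩
  · intro i j h
    have hi := ZMod.val_lt i
    have hj := ZMod.val_lt j
    have := hw.getVert_injOn (x₁ := 2 * i.val + 1) (x₂ := 2 * j.val + 1)
      ⟨by omega, by omega⟩ ⟨by omega, by omega⟩ (by rw [hρ, hρ, h])
    exact ZMod.val_injective k (by omega)
  · intro i j h
    have hi := ZMod.val_lt i
    have hj := ZMod.val_lt j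
    have := hw.getVert_injOn' (x₁ := 2 * i.val) (x₂ := 2 * j.val)
      (show 2 * i.val ≤ w.length - 1 by omega) (show 2 * j.val ≤ w.length - 1 by omega) (by rw [hγ, hγ, h])
    exact ZMod.val_injective k (by omega)
  · ext e
    induction e using Sym2.ind with | _ x y =>
    rw [List.mem_toFinset, SimpleGraph.Walk.mk_mem_edges_iff_exists, mem_image]
    constructor
    · rintro ⟨j, hj, h⟩
      rw [← h]
      rcases Nat.even_or_odd' j with ⟨m, rfl | rfl⟩
      · have hm : ((m : ZMod k)).val = m := ZMod.val_natCast_of_lt (by omega)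
        refine ⟨(ρ (m : ZMod k), γ (m : ZMod k)), ?_, ?_⟩
        · exact mem_union_left _ (mem_image.2 ⟨_, mem_univ _, rfl⟩)
        · have h1 := hρ (m : ZMod k)
          have h2 := hγ (m : ZMod k)
          rw [hm] at h1 h2
          rw [emb, h1, h2, Sym2.eq_swap]
      · have hm : ((m : ZMod k)).val = m := ZMod.val_natCast_of_lt (by omega)
        refine ⟨(ρ (m : ZMod k), γ ((m : ZMod k) + 1)), ?_, ?_⟩
        · exact mem_union_right _ (mem_image.2 ⟨_, mem_univ _, rfl⟩)
        · have h1 := hρ (m : ZMod k)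
          have h2 := hγ1 (m : ZMod k)
          rw [hm] at h1 h2
          rw [emb, h1, h2]
    · rintro ⟨p, hp, h⟩
      rw [← h]
      simp only [cyc, mem_union, mem_image, mem_univ, true_and] at hp
      rcases hp with ⟨i, rfl⟩ | ⟨i, rfl⟩
      · have hi := ZMod.val_lt i
        exact ⟨2 * i.val, by omega, by rw [hγ, hρ, emb, Sym2.eq_swap]⟩
      · have hi := ZMod.val_lt i
        exact ⟨2 * i.val + 1, by omega, by rw [hγ1, hρ, emb]⟩

theorem forward {n k : ℕ} [NeZero k] {E : Finset (Sym2 (Fin n ⊕ Fin n))}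
    (hE : E ∈ bipCycleFamily n (2 * k)) :
    ∃ C : Finset (Fin n × Fin n), IsCyc k C ∧ E = C.image emb := by
  obtain ⟨v, w, hw, hl, rfl⟩ := hE
  have hk0 := NeZero.pos k
  rcases v with v | v
  · have hadj := w.adj_getVert_succ (i := 0) (by omega)
    rw [SimpleGraph.Walk.getVert_zero] at hadj
    have hmem := w.getVert_mem_support (0 + 1)
    obtain ⟨u, hu⟩ : ∃ u, w.getVert (0 + 1) = Sum.inr u := by
      rcases hx : w.getVert (0 + 1) with r | r
      · rw [hx] at hadj; simp at hadj
      · exact ⟨r, rfl⟩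
    rw [hu] at hmem
    obtain ⟨C, hC, h⟩ := forward_aux (k := k) (w.rotate _ hmem)
      ((SimpleGraph.Walk.isCycle_rotate hmem).2 hw) (by rw [SimpleGraph.Walk.length_rotate, hl])
    refine ⟨C, hC, ?_⟩
    rw [← h]
    ext e
    rw [List.mem_toFinset, List.mem_toFinset, (w.rotate_edges _ hmem).mem_iff]
  · exact forward_aux w hw hl

theorem backward {n k : ℕ} [NeZero k] (hkn : k ≤ n) {E : Finset (Sym2 (Fin n ⊕ Fin n))}
    (hE : E ∈ bipCycleFamily n (2 * k)) {C : Finset (Fin n × Fin n)} (hC : IsCyc k C) :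
    C.image emb ∈ bipCycleFamily n (2 * k) := by
  haveI : NeZero n := ⟨by have := NeZero.pos k; omega⟩
  obtain ⟨C0, hC0, hE0⟩ := forward hE
  have hV : Fintype.card (Fin n) = n := Fintype.card_fin n
  obtain ⟨σ, τ, rfl⟩ := (isCyc_iff hV hkn C).1 hC
  obtain ⟨σ0, τ0, rfl⟩ := (isCyc_iff hV hkn C0).1 hC0
  obtain ⟨v, w, hw, hl, hEw⟩ := hE
  let φ := SimpleGraph.completeBipartiteGraphCongr (σ0.symm.trans σ) (τ0.symm.trans τ)
  refine ⟨φ v, w.map φ.toHom, hw.map φ.injective, by rw [SimpleGraph.Walk.length_map, hl], ?_⟩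
  have hmap : ((w.map φ.toHom).edges).toFinset = w.edges.toFinset.image (Sym2.map φ.toHom) := by
    rw [SimpleGraph.Walk.edges_map]
    ext e
    simp
  rw [hmap, ← hEw, hE0, mv, mv, image_image, image_image, image_image]
  apply image_congr
  rintro ⟨x, y⟩ -
  simp [emb, φ, SimpleGraph.completeBipartiteGraphCongr]

open Classical in
/-- the cell sets whose edge sets belong to a family -/
noncomputable def pull {n : ℕ} (B : Set (Finset (Sym2 (Fin n ⊕ Fin n)))) :
    Finset (Finset (Fin n × Fin n)) :=
  univ.filter (fun C => C.image emb ∈ B)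

theorem mem_pull {n : ℕ} {B : Set (Finset (Sym2 (Fin n ⊕ Fin n)))} {C : Finset (Fin n × Fin n)} :
    C ∈ pull B ↔ C.image emb ∈ B := by
  simp [pull]

theorem ncard_pull {n k : ℕ} [NeZero k] {B : Set (Finset (Sym2 (Fin n ⊕ Fin n)))}
    (hB : B ⊆ bipCycleFamily n (2 * k)) : B.ncard = #(pull B) := by
  have : B = (fun C : Finset (Fin n × Fin n) => C.image emb) '' (pull B : Set _) := by
    ext E
    simp only [Set.mem_image, mem_coe, mem_pull]
    constructor
    · intro hE
      obtain ⟨C, -, rfl⟩ := forward (hB hE)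
      exact ⟨C, hE, rfl⟩
    · rintro ⟨C, hC, rfl⟩
      exact hC
  conv_lhs => rw [this]
  rw [Set.ncard_image_of_injective _ (Finset.image_injective emb_inj), Set.ncard_coe_finset]

theorem edge_emb {n : ℕ} {x : Sym2 (Fin n ⊕ Fin n)}
    (hx : x ∈ (completeBipartiteGraph (Fin n) (Fin n)).edgeSet) : ∃ e, x = emb e := by
  induction x using Sym2.ind with | _ a b =>
  rw [SimpleGraph.mem_edgeSet] at hx
  rcases a with a | a <;> rcases b with b | b
  · simp at hx
  · exact ⟨(a, b), rfl⟩
  · exact ⟨(b, a), Sym2.eq_swap⟩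
  · simp at hx

theorem emb_edge {n : ℕ} (e : Fin n × Fin n) :
    emb e ∈ (completeBipartiteGraph (Fin n) (Fin n)).edgeSet := by
  simp [emb]

theorem famAt_int {α : Type*} (A : Set (Finset α)) (x : α) : IsIntersectingFamily (famAt A x) :=
  fun _ hE _ hF => ⟨x, hE.2, hF.2⟩

/-- transfer of the model theorem to graphs -/
theorem transfer {n k : ℕ} [NeZero k] (hk : 2 ≤ k) (hn : 2 * k ≤ n)
    (e : Fin n × Fin n) {B : Set (Finset (Sym2 (Fin n ⊕ Fin n)))}
    (hB : B ⊆ bipCycleFamily n (2 * k)) (hint : IsIntersectingFamily B) (hne : B.Nonempty) :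
    B.ncard ≤ (famAt (bipCycleFamily n (2 * k)) (emb e)).ncard ∧ (2 * k < n →
      B.ncard = (famAt (bipCycleFamily n (2 * k)) (emb e)).ncard →
      ∃ e', ∀ E ∈ B, emb e' ∈ E) := by
  obtain ⟨E0, hE0⟩ := hne
  have hfam : ∀ C : Finset (Fin n × Fin n),
      C.image emb ∈ bipCycleFamily n (2 * k) ↔ IsCyc k C := by
    intro C
    constructor
    · intro h
      obtain ⟨C', hC', h'⟩ := forward h
      rw [Finset.image_injective emb_inj h']
      exact hC'
    · exact backward (by omega) (hB hE0)
  rw [ncard_pull hB, ncard_pull (k := k) (B := famAt _ (emb e)) (fun _ h => h.1)]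
  have M := main_model (Fintype.card_fin n) hk hn
    (pull (famAt (bipCycleFamily n (2 * k)) (emb e))) (pull B) e (by
      intro C
      rw [mem_pull]
      show C.image emb ∈ _ ∧ emb e ∈ C.image emb ↔ _
      rw [hfam, mem_image]
      constructor
      · rintro ⟨h, c, hc, h'⟩
        exact ⟨h, emb_inj h' ▸ hc⟩
      · rintro ⟨h, h'⟩
        exact ⟨h, e, h', rfl⟩) (by
      intro C hC
      exact (hfam C).1 (hB (mem_pull.1 hC))) (by
      intro C hC D hD
      obtain ⟨x, h1, h2⟩ := hint _ (mem_pull.1 hC) _ (mem_pull.1 hD)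
      rw [mem_image] at h1 h2
      obtain ⟨c, hc, rfl⟩ := h1
      obtain ⟨d, hd, h⟩ := h2
      exact ⟨c, hc, emb_inj h ▸ hd⟩)
  refine ⟨M.1, fun h1 h2 => ?_⟩
  obtain ⟨e', he'⟩ := M.2 h1 h2
  refine ⟨e', fun E hE => ?_⟩
  obtain ⟨C, -, rfl⟩ := forward (hB hE)
  exact mem_image_of_mem _ (he' C (mem_pull.2 hE))

theorem ekr {n k : ℕ} (hk : 2 ≤ k) (hn : 2 * k ≤ n) :
    IsEKRFamily (completeBipartiteGraph (Fin n) (Fin n)).edgeSet (bipCycleFamily n (2 * k)) := by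
  have : NeZero k := ⟨by omega⟩
  intro x hx B hB hint
  obtain ⟨e, rfl⟩ := edge_emb hx
  rcases B.eq_empty_or_nonempty with rfl | hne
  · simp
  · exact (transfer hk hn e hB hint hne).1

theorem strong {n k : ℕ} (hk : 2 ≤ k) (hn : 2 * k < n) :
    IsStrongEKRFamily (completeBipartiteGraph (Fin n) (Fin n)).edgeSet
      (bipCycleFamily n (2 * k)) := by
  have : NeZero k := ⟨by omega⟩
  refine ⟨ekr hk hn.le, fun B hB hint hmax => ?_⟩
  let z : Fin n := ⟨0, by omega⟩
  have hstar : ∀ e, (famAt (bipCycleFamily n (2 * k)) (emb e)).ncard ≤ B.ncard :=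
    fun e => hmax _ (fun _ h => h.1) (famAt_int _ _)
  have key : ∃ e', ∀ E ∈ B, emb e' ∈ E := by
    rcases B.eq_empty_or_nonempty with rfl | hne
    · exact ⟨(z, z), by simp⟩
    · have T := transfer hk hn.le (z, z) hB hint hne
      exact T.2 hn (le_antisymm T.1 (hstar _))
  obtain ⟨e', he'⟩ := key
  refine ⟨emb e', emb_edge e', ?_⟩
  exact Set.eq_of_subset_of_ncard_le (fun E hE => ⟨hB hE, he' E hE⟩) (hstar e') (Set.toFinite _)

end BC

/-- Let `k ≥ 2`. For every `n ≥ 2k` the family of all `2k`-cycles of `K_{n,n}` is an EKR family,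
and for every `n > 2k` it is a strong EKR family. -/
theorem bipCycles_EKR (k n : ℕ) (hk : 2 ≤ k) :
    (2 * k ≤ n →
      IsEKRFamily (completeBipartiteGraph (Fin n) (Fin n)).edgeSet (bipCycleFamily n (2 * k))) ∧
    (2 * k < n →
      IsStrongEKRFamily (completeBipartiteGraph (Fin n) (Fin n)).edgeSet
        (bipCycleFamily n (2 * k))) := by
  exact ⟨fun h => BC.ekr hk h, fun h => BC.strong hk h⟩
end

section
/- Let H be a connected bipartite graph. There exists a constant n_0(H) such that for every integer n ≥ n_0(H), the family ℬ_n(H) consisting of all subgraphs of the complete bipartite graph K_{n,n} that are isomorphic to H is a strong EKR family. -/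
/-- The family of all subgraphs of the complete bipartite graph `K_{n,n}` that are isomorphic
to the graph `H`, each copy being identified with its edge set: a copy is the image of the
edge set of `H` under an injective map of its vertices into `K_{n,n}` sending edges of `H`
to edges of `K_{n,n}`. -/
def bipCopies {V : Type*} [Fintype V] [DecidableEq V] (H : SimpleGraph V) [DecidableRel H.Adj]
    (n : ℕ) : Set (Finset (Sym2 (Fin n ⊕ Fin n))) :=
  {E | ∃ φ : V → Fin n ⊕ Fin n, Function.Injective φ ∧
      (∀ u v : V, H.Adj u v → (completeBipartiteGraph (Fin n) (Fin n)).Adj (φ u) (φ v)) ∧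
      E = H.edgeFinset.image (Sym2.map φ)}

open Finset in
theorem aux_pair {n m : ℕ} (𝒜 : Finset (Finset (Sym2 (Fin n ⊕ Fin n))))
    (hcard : ∀ E ∈ 𝒜, E.card ≤ m)
    (hsymm : ∀ σ : Equiv.Perm (Fin n ⊕ Fin n), (∀ x, (σ x).isLeft = x.isLeft) →
      ∀ E ∈ 𝒜, E.image (Sym2.map σ) ∈ 𝒜)
    (hn : (2 * m + 1) + (2 * m + 1) * (m ^ 2 + 1) ≤ n)
    (e f : Sym2 (Fin n ⊕ Fin n)) (w : Fin n ⊕ Fin n) (hwf : w ∈ f) (hwe : w ∉ e) :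
    (𝒜.filter (fun E => e ∈ E ∧ f ∈ E)).card * (m ^ 2 + 1)
      ≤ (𝒜.filter (fun E => e ∈ E)).card := by
  classical
  let vs : Finset (Sym2 (Fin n ⊕ Fin n)) → Finset (Fin n ⊕ Fin n) :=
    fun E => E.biUnion (fun x => x.toFinset)
  have hvs : ∀ E ∈ 𝒜, (vs E).card ≤ 2 * m + 1 := by
    intro E hE
    have h1 : (vs E).card ≤ E.card * 2 := by
      apply Finset.card_biUnion_le_card_mul
      intro x _
      rw [Sym2.card_toFinset]
      split_ifs <;> omega
    have := hcard E hE
    omega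
  let side : Finset (Fin n ⊕ Fin n) := univ.filter (fun x => x.isLeft = w.isLeft)
  have hside : n ≤ side.card := by
    cases w with
    | inl i =>
      calc n = (univ.image (Sum.inl : Fin n → Fin n ⊕ Fin n)).card := by
            rw [card_image_of_injective _ Sum.inl_injective]; simp
        _ ≤ _ := by
            apply card_le_card
            intro x hx
            simp only [mem_image] at hx
            obtain ⟨a, -, rfl⟩ := hx
            exact mem_filter.2 ⟨mem_univ _, rfl⟩
    | inr i =>
      calc n = (univ.image (Sum.inr : Fin n → Fin n ⊕ Fin n)).card := by
            rw [card_image_of_injective _ Sum.inr_injective]; simp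
        _ ≤ _ := by
            apply card_le_card
            intro x hx
            simp only [mem_image] at hx
            obtain ⟨a, -, rfl⟩ := hx
            exact mem_filter.2 ⟨mem_univ _, rfl⟩
  set M := 𝒜.filter (fun E => e ∈ E ∧ f ∈ E) with hM
  set N := 𝒜.filter (fun E => e ∈ E) with hN
  have key : (M.sigma (fun E => side \ vs E)).card ≤ (N.sigma (fun E => vs E)).card := by
    apply Finset.card_le_card_of_injOn
      (fun p => ⟨p.1.image (Sym2.map (Equiv.swap w p.2)), p.2⟩)
    · rintro ⟨E, v⟩ hp
      simp only [coe_sigma, Set.mem_sigma_iff, mem_coe, hM, mem_filter, mem_sdiff, side, mem_univ,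
        true_and] at hp
      obtain ⟨⟨hE, heE, hfE⟩, hv, hvE⟩ := hp
      have hve : v ∉ e := by
        intro h
        exact hvE (mem_biUnion.2 ⟨e, heE, by simpa using h⟩)
      simp only [coe_sigma, Set.mem_sigma_iff, mem_coe, hN, mem_filter]
      refine ⟨⟨hsymm _ ?_ E hE, ?_⟩, ?_⟩
      · intro x
        rw [Equiv.swap_apply_def]
        split_ifs with h1 h2
        · rw [hv, h1]
        · rw [h2, hv]
        · rfl
      · rw [mem_image]
        refine ⟨e, heE, ?_⟩
        have : Sym2.map (Equiv.swap w v) e = Sym2.map id e := by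
          apply Sym2.map_congr
          intro x hx
          apply Equiv.swap_apply_of_ne_of_ne
          · rintro rfl; exact hwe hx
          · rintro rfl; exact hve hx
        simpa using this
      · refine mem_biUnion.2 ⟨_, mem_image_of_mem _ hfE, ?_⟩
        rw [Sym2.mem_toFinset, Sym2.mem_map]
        exact ⟨w, hwf, by simp⟩
    · rintro ⟨E, v⟩ _ ⟨E', v'⟩ _ h
      simp only [Sigma.mk.injEq, heq_eq_eq] at h
      obtain ⟨h1, rfl⟩ := h
      have := Finset.image_injective (Sym2.map.injective (Equiv.swap w v).injective) h1
      rw [this]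
  rw [card_sigma, card_sigma] at key
  have h1 : M.card * ((2 * m + 1) * (m ^ 2 + 1)) ≤ ∑ E ∈ M, (side \ vs E).card := by
    rw [← smul_eq_mul]
    apply Finset.card_nsmul_le_sum
    intro E hE
    have h2 := hvs E (mem_filter.1 hE).1
    have h3 := le_card_sdiff (vs E) side
    omega
  have h2 : ∑ E ∈ N, (vs E).card ≤ N.card * (2 * m + 1) := by
    rw [← smul_eq_mul]
    apply Finset.sum_le_card_nsmul
    intro E hE
    exact hvs E (mem_filter.1 hE).1
  have h3 := (h1.trans key).trans h2
  have h4 : (2 * m + 1) * (M.card * (m ^ 2 + 1)) ≤ (2 * m + 1) * N.card := by linarith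
  exact Nat.le_of_mul_le_mul_left h4 (by omega)

theorem exists_mem_notMem_of_adj {n : ℕ} (e f : Sym2 (Fin n ⊕ Fin n))
    (he : e ∈ (completeBipartiteGraph (Fin n) (Fin n)).edgeSet)
    (hf : f ∈ (completeBipartiteGraph (Fin n) (Fin n)).edgeSet) (hne : e ≠ f) :
    ∃ w, w ∈ f ∧ w ∉ e := by
  by_contra! hcon
  induction f with | _ a b
  have hab : a ≠ b := (SimpleGraph.mem_edgeSet _).1 hf |>.ne
  exact hne ((Sym2.mem_and_mem_iff hab).1 ⟨hcon a (by simp), hcon b (by simp)⟩)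

open Finset in
theorem aux_famAt_le {n : ℕ} (𝒜 : Finset (Finset (Sym2 (Fin n ⊕ Fin n))))
    (hsymm : ∀ σ : Equiv.Perm (Fin n ⊕ Fin n), (∀ x, (σ x).isLeft = x.isLeft) →
      ∀ E ∈ 𝒜, E.image (Sym2.map σ) ∈ 𝒜)
    (e f : Sym2 (Fin n ⊕ Fin n))
    (he : e ∈ (completeBipartiteGraph (Fin n) (Fin n)).edgeSet)
    (hf : f ∈ (completeBipartiteGraph (Fin n) (Fin n)).edgeSet) :
    (𝒜.filter (fun E => e ∈ E)).card ≤ (𝒜.filter (fun E => f ∈ E)).card := by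
  classical
  have form : ∀ e ∈ (completeBipartiteGraph (Fin n) (Fin n)).edgeSet,
      ∃ i j, e = s(Sum.inl i, Sum.inr j) := by
    intro e he
    induction e with | _ a b
    rw [SimpleGraph.mem_edgeSet] at he
    rcases a with a | a <;> rcases b with b | b <;> simp at he
    · exact ⟨a, b, rfl⟩
    · exact ⟨b, a, Sym2.eq_swap⟩
  obtain ⟨i, j, rfl⟩ := form e he
  obtain ⟨i', j', rfl⟩ := form f hf
  let σ : Equiv.Perm (Fin n ⊕ Fin n) := Equiv.sumCongr (Equiv.swap i i') (Equiv.swap j j')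
  have hσ : ∀ x, (σ x).isLeft = x.isLeft := by
    rintro (x | x) <;> simp [σ]
  apply Finset.card_le_card_of_injOn (fun E => E.image (Sym2.map σ))
  · intro E hE
    simp only [mem_coe, mem_filter] at hE ⊢
    refine ⟨hsymm σ hσ E hE.1, mem_image.2 ⟨_, hE.2, ?_⟩⟩
    simp [σ]
  · exact (Finset.image_injective (Sym2.map.injective σ.injective)).injOn

open Finset in
theorem aux_trichotomy {n m : ℕ} (𝒜 : Finset (Finset (Sym2 (Fin n ⊕ Fin n))))
    (hcard : ∀ E ∈ 𝒜, E.card ≤ m)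
    (hedge : ∀ E ∈ 𝒜, ∀ e ∈ E, e ∈ (completeBipartiteGraph (Fin n) (Fin n)).edgeSet)
    (hsymm : ∀ σ : Equiv.Perm (Fin n ⊕ Fin n), (∀ x, (σ x).isLeft = x.isLeft) →
      ∀ E ∈ 𝒜, E.image (Sym2.map σ) ∈ 𝒜)
    (hn : (2 * m + 1) + (2 * m + 1) * (m ^ 2 + 1) ≤ n)
    (F : Finset (Finset (Sym2 (Fin n ⊕ Fin n)))) (hF : F ⊆ 𝒜)
    (hint : ∀ A ∈ F, ∀ B ∈ F, ∃ x, x ∈ A ∧ x ∈ B) (hne : F.Nonempty)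
    (x : Sym2 (Fin n ⊕ Fin n))
    (hx : x ∈ (completeBipartiteGraph (Fin n) (Fin n)).edgeSet) :
    (∃ e ∈ (completeBipartiteGraph (Fin n) (Fin n)).edgeSet, F ⊆ 𝒜.filter (fun E => e ∈ E)) ∨
      F.card < (𝒜.filter (fun E => x ∈ E)).card := by
  classical
  by_cases hc : ∃ e, ∀ E ∈ F, e ∈ E
  · left
    obtain ⟨e, he⟩ := hc
    obtain ⟨A, hA⟩ := hne
    exact ⟨e, hedge A (hF hA) e (he A hA), fun E hE => mem_filter.2 ⟨hF hE, he E hE⟩⟩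
  · right
    push Not at hc
    choose B hB hBe using hc
    obtain ⟨A, hA⟩ := hne
    set N := (𝒜.filter (fun E => x ∈ E)).card with hN
    have hsub : F ⊆ A.biUnion (fun e => (B e).biUnion
        (fun f => 𝒜.filter (fun E => e ∈ E ∧ f ∈ E))) := by
      intro E hE
      obtain ⟨e, heA, heE⟩ := hint A hA E hE
      obtain ⟨f, hfB, hfE⟩ := hint (B e) (hB e) E hE
      simp only [mem_biUnion, mem_filter]
      exact ⟨e, heA, f, hfB, hF hE, heE, hfE⟩
    have hbound : F.card * (m ^ 2 + 1) ≤ m ^ 2 * N := by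
      calc F.card * (m ^ 2 + 1)
          ≤ (∑ e ∈ A, ∑ f ∈ B e, (𝒜.filter (fun E => e ∈ E ∧ f ∈ E)).card) * (m ^ 2 + 1) := by
            gcongr
            refine (card_le_card hsub).trans (card_biUnion_le.trans ?_)
            exact sum_le_sum fun e _ => card_biUnion_le
        _ = ∑ e ∈ A, ∑ f ∈ B e, (𝒜.filter (fun E => e ∈ E ∧ f ∈ E)).card * (m ^ 2 + 1) := by
            rw [sum_mul]
            exact sum_congr rfl fun e _ => sum_mul _ _ _
        _ ≤ ∑ e ∈ A, ∑ f ∈ B e, N := by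
            refine sum_le_sum fun e he => sum_le_sum fun f hf => ?_
            have he' := hedge A (hF hA) e he
            have hf' := hedge _ (hF (hB e)) f hf
            obtain ⟨w, hwf, hwe⟩ := exists_mem_notMem_of_adj e f he' hf'
              (by rintro rfl; exact hBe e hf)
            exact (aux_pair 𝒜 hcard hsymm hn e f w hwf hwe).trans
              (aux_famAt_le 𝒜 hsymm e x he' hx)
        _ ≤ ∑ e ∈ A, m * N := by
            refine sum_le_sum fun e he => ?_
            rw [sum_const, smul_eq_mul]
            exact Nat.mul_le_mul_right _ (hcard _ (hF (hB e)))
        _ ≤ m * (m * N) := by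
            rw [sum_const, smul_eq_mul]
            exact Nat.mul_le_mul_right _ (hcard _ (hF hA))
        _ = m ^ 2 * N := by ring
    have hpos : 0 < F.card := card_pos.2 ⟨A, hA⟩
    by_contra! hlt
    have := Nat.mul_le_mul_left (m ^ 2) hlt
    nlinarith

/-- For every connected bipartite graph `H` there is a constant `n₀` such that for all
`n ≥ n₀` the family of all copies of `H` in `K_{n,n}` is a strong EKR family. -/
theorem bipCopies_strongEKR {V : Type*} [Fintype V] [DecidableEq V]
    (H : SimpleGraph V) [DecidableRel H.Adj]
    (hconn : H.Connected) (hbip : H.Colorable 2) :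
    ∃ n₀ : ℕ, ∀ n : ℕ, n₀ ≤ n →
      IsStrongEKRFamily (completeBipartiteGraph (Fin n) (Fin n)).edgeSet (bipCopies H n) := by
  classical
  set m := H.edgeFinset.card with hm
  refine ⟨(2 * m + 1) + (2 * m + 1) * (m ^ 2 + 1), fun n hn => ?_⟩
  obtain ⟨𝒜, h𝒜⟩ : ∃ 𝒜 : Finset (Finset (Sym2 (Fin n ⊕ Fin n))), (𝒜 : Set _) = bipCopies H n :=
    ⟨(bipCopies H n).toFinite.toFinset, by simp⟩
  have hmem : ∀ E, E ∈ 𝒜 ↔ E ∈ bipCopies H n := fun E => by rw [← h𝒜, Finset.mem_coe]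
  have hcard : ∀ E ∈ 𝒜, E.card ≤ m := by
    intro E hE
    obtain ⟨φ, -, -, rfl⟩ := (hmem E).1 hE
    exact Finset.card_image_le
  have hedge : ∀ E ∈ 𝒜, ∀ e ∈ E, e ∈ (completeBipartiteGraph (Fin n) (Fin n)).edgeSet := by
    intro E hE e he
    obtain ⟨φ, -, hφ, rfl⟩ := (hmem E).1 hE
    obtain ⟨d, hd, rfl⟩ := Finset.mem_image.1 he
    induction d with | _ a b
    rw [SimpleGraph.mem_edgeFinset, SimpleGraph.mem_edgeSet] at hd
    exact hφ a b hd
  have hsymm : ∀ σ : Equiv.Perm (Fin n ⊕ Fin n), (∀ x, (σ x).isLeft = x.isLeft) →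
      ∀ E ∈ 𝒜, E.image (Sym2.map σ) ∈ 𝒜 := by
    intro σ hσ E hE
    obtain ⟨φ, hinj, hφ, rfl⟩ := (hmem E).1 hE
    refine (hmem _).2 ⟨σ ∘ φ, σ.injective.comp hinj, ?_, ?_⟩
    · intro u v huv
      have h := hφ u v huv
      have hr : ∀ x, (σ x).isRight = x.isRight := by
        intro x
        rw [Bool.eq_iff_iff, ← Sum.not_isLeft, ← Sum.not_isLeft, hσ]
      simpa only [completeBipartiteGraph_adj, Function.comp, hσ, hr] using h
    · rw [Finset.image_image, Sym2.map_comp]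
  have hfam : ∀ x, famAt (bipCopies H n) x = ((𝒜.filter (fun E => x ∈ E) : Finset _) : Set _) := by
    intro x
    ext E
    simp [famAt, hmem]
  have hX : ∃ x, x ∈ (completeBipartiteGraph (Fin n) (Fin n)).edgeSet := by
    have hn0 : 0 < n := by omega
    exact ⟨s(Sum.inl ⟨0, hn0⟩, Sum.inr ⟨0, hn0⟩), by simp⟩
  rw [← h𝒜] at *
  refine ⟨?_, ?_⟩
  · intro x hx ℬ hℬ hint
    obtain ⟨F, rfl⟩ : ∃ F : Finset (Finset (Sym2 (Fin n ⊕ Fin n))), (F : Set _) = ℬ :=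
      ⟨ℬ.toFinite.toFinset, by simp⟩
    rw [hfam, Set.ncard_coe_finset, Set.ncard_coe_finset]
    rcases F.eq_empty_or_nonempty with rfl | hne
    · simp
    rcases aux_trichotomy 𝒜 hcard hedge hsymm hn F (by exact_mod_cast hℬ) hint hne x hx with
      ⟨e, he, hsub⟩ | hlt
    · exact (Finset.card_le_card hsub).trans (aux_famAt_le 𝒜 hsymm e x he hx)
    · exact hlt.le
  · intro ℬ hℬ hint hmax
    obtain ⟨F, rfl⟩ : ∃ F : Finset (Finset (Sym2 (Fin n ⊕ Fin n))), (F : Set _) = ℬ :=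
      ⟨ℬ.toFinite.toFinset, by simp⟩
    obtain ⟨x, hx⟩ := hX
    have hmax' : ∀ y, (𝒜.filter (fun E => y ∈ E)).card ≤ F.card := by
      intro y
      have := hmax (famAt 𝒜 y) (fun E hE => hE.1) (fun A hA B hB => ⟨y, hA.2, hB.2⟩)
      rwa [hfam, Set.ncard_coe_finset, Set.ncard_coe_finset] at this
    rcases F.eq_empty_or_nonempty with rfl | hne
    · refine ⟨x, hx, ?_⟩
      have h := hmax' x
      rw [Finset.card_empty, Nat.le_zero, Finset.card_eq_zero] at h
      rw [hfam, h]
    rcases aux_trichotomy 𝒜 hcard hedge hsymm hn F (by exact_mod_cast hℬ) hint hne x hx with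
      ⟨e, he, hsub⟩ | hlt
    · refine ⟨e, he, ?_⟩
      rw [hfam, Finset.eq_of_subset_of_card_le hsub (hmax' e)]
    · exact absurd (hmax' x) (not_le.2 hlt)
end

section
/- Let H be an r-uniform hypergraph. There exists a constant n_0(H) such that for every integer n ≥ n_0(H), the family ℱ_n(H) consisting of all subhypergraphs of the complete r-uniform hypergraph K_n^{(r)} that are isomorphic to H is a strong EKR family. -/
/-- The family of all copies of a hypergraph with vertex type `V` and hyperedge set `EH`
inside the complete `r`-uniform hypergraph on `Fin n`: a copy is the image of the hyperedge
set under an injective map of the vertices into `Fin n`; each copy is identified with its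
set of hyperedges. -/
def hypCopies {V : Type*} [DecidableEq V] (EH : Finset (Finset V)) (n : ℕ) :
    Set (Finset (Finset (Fin n))) :=
  {E | ∃ φ : V → Fin n, Function.Injective φ ∧ E = EH.image (Finset.image φ)}

section EKRHelpers

variable {V : Type*} [DecidableEq V]

lemma hypCopies_card {EH : Finset (Finset V)} {n : ℕ} {A : Finset (Finset (Fin n))}
    (hA : A ∈ hypCopies EH n) : A.card = EH.card := by
  obtain ⟨φ, hφ, rfl⟩ := hA
  exact Finset.card_image_of_injective _ (Finset.image_injective hφ)

lemma hypCopies_edge_card {r : ℕ} {EH : Finset (Finset V)} (hEH : ∀ e ∈ EH, e.card = r)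
    {n : ℕ} {A : Finset (Finset (Fin n))} (hA : A ∈ hypCopies EH n) {e : Finset (Fin n)}
    (he : e ∈ A) : e.card = r := by
  obtain ⟨φ, hφ, rfl⟩ := hA
  obtain ⟨e0, he0, rfl⟩ := Finset.mem_image.1 he
  rw [Finset.card_image_of_injective _ hφ, hEH e0 he0]

lemma hypCopies_perm {EH : Finset (Finset V)} {n : ℕ} (σ : Equiv.Perm (Fin n))
    {A : Finset (Finset (Fin n))} (hA : A ∈ hypCopies EH n) :
    A.image (Finset.image σ) ∈ hypCopies EH n := by
  obtain ⟨φ, hφ, rfl⟩ := hA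
  refine ⟨σ ∘ φ, σ.injective.comp hφ, ?_⟩
  rw [Finset.image_image]
  congr 1
  funext x
  simp [Finset.image_image]

lemma famAt_perm_le (EH : Finset (Finset V)) {n : ℕ} (σ : Equiv.Perm (Fin n))
    (e f : Finset (Fin n)) :
    (famAt (hypCopies EH n) e ∩ famAt (hypCopies EH n) f).ncard ≤
      (famAt (hypCopies EH n) (e.image σ) ∩ famAt (hypCopies EH n) (f.image σ)).ncard := by
  refine Set.ncard_le_ncard_of_injOn (fun A => A.image (Finset.image σ)) ?_ ?_ (Set.toFinite _)
  · rintro A ⟨⟨hA, he⟩, ⟨_, hf⟩⟩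
    exact ⟨⟨hypCopies_perm σ hA, Finset.mem_image_of_mem _ he⟩,
      ⟨hypCopies_perm σ hA, Finset.mem_image_of_mem _ hf⟩⟩
  · exact (Finset.image_injective (Finset.image_injective σ.injective)).injOn

lemma exists_perm_image {n : ℕ} {e f : Finset (Fin n)} (h : e.card = f.card) :
    ∃ σ : Equiv.Perm (Fin n), e.image σ = f := by
  let g : {x // x ∈ e} ≃ {x // x ∈ f} := Finset.equivOfCardEq h
  refine ⟨g.extendSubtype, ?_⟩
  apply Finset.eq_of_subset_of_card_le
  · intro y hy
    obtain ⟨x, hx, rfl⟩ := Finset.mem_image.1 hy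
    exact g.extendSubtype_mem x hx
  · rw [Finset.card_image_of_injective _ (Equiv.injective _), h]

lemma famAt_card_le (EH : Finset (Finset V)) {n : ℕ} {e f : Finset (Fin n)}
    (h : e.card = f.card) :
    (famAt (hypCopies EH n) e).ncard ≤ (famAt (hypCopies EH n) f).ncard := by
  obtain ⟨σ, rfl⟩ := exists_perm_image h
  simpa using famAt_perm_le EH σ e e

/-- Few copies contain two distinct edges. -/
lemma famAt_pair (EH : Finset (Finset V)) {n r : ℕ} {e f : Finset (Fin n)}
    (he : e.card = r) (hf : f.card = r) (hne : e ≠ f) :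
    (n - 2 * r) * (famAt (hypCopies EH n) e ∩ famAt (hypCopies EH n) f).ncard ≤
      EH.card * (famAt (hypCopies EH n) e).ncard := by
  classical
  obtain ⟨x, hxf, hxe⟩ : ∃ x ∈ f, x ∉ e := by
    by_contra! hc
    exact hne (Finset.eq_of_subset_of_card_le hc (by omega)).symm
  set Z : Finset (Fin n) := (e ∪ f)ᶜ with hZ
  have hZc : n - 2 * r ≤ Z.card := by
    rw [hZ, Finset.card_compl, Fintype.card_fin]
    have := Finset.card_union_le e f
    omega
  have hZm : ∀ z ∈ Z, z ∉ e ∧ z ∉ f := by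
    intro z hz
    simpa [hZ] using hz
  let F : Fin n → Finset (Fin n) := fun z => f.image (Equiv.swap x z)
  have hFz : ∀ z, z ∈ F z := fun z =>
    Finset.mem_image.2 ⟨x, hxf, Equiv.swap_apply_left x z⟩
  have hFinj : ∀ z ∈ Z, ∀ w ∈ Z, F z = F w → z = w := by
    intro z hz w hw h
    by_contra hzw
    have h1 : z ∈ F w := h ▸ hFz z
    obtain ⟨y, hy, hyz⟩ := Finset.mem_image.1 h1
    have hy2 : y = Equiv.swap x w z := by rw [← hyz, Equiv.swap_apply_self]
    have hzx : z ≠ x := fun h => (hZm z hz).2 (h ▸ hxf)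
    rw [Equiv.swap_apply_of_ne_of_ne hzx hzw] at hy2
    exact (hZm z hz).2 (hy2 ▸ hy)
  have hfix : ∀ z ∈ Z, e.image (Equiv.swap x z) = e := by
    intro z hz
    have : ∀ y ∈ e, Equiv.swap x z y = y := by
      intro y hy
      apply Equiv.swap_apply_of_ne_of_ne
      · rintro rfl; exact hxe hy
      · rintro rfl; exact (hZm _ hz).1 hy
    calc e.image (Equiv.swap x z) = e.image id := Finset.image_congr this
      _ = e := Finset.image_id
  set S : Finset (Finset (Finset (Fin n))) := (famAt (hypCopies EH n) e).toFinite.toFinset with hS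
  have hSc : (famAt (hypCopies EH n) e).ncard = S.card := Set.ncard_eq_toFinset_card _ _
  have hpair : ∀ g, (famAt (hypCopies EH n) e ∩ famAt (hypCopies EH n) g).ncard
      = (S.filter (fun A => g ∈ A)).card := by
    intro g
    rw [← Set.ncard_coe_finset]
    congr 1
    ext A
    simp [hS, famAt]
    tauto
  set P := (famAt (hypCopies EH n) e ∩ famAt (hypCopies EH n) f).ncard with hP
  have hle : ∀ z ∈ Z, P ≤ (S.filter (fun A => F z ∈ A)).card := by
    intro z hz
    have := famAt_perm_le EH (Equiv.swap x z) e f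
    rw [hfix z hz] at this
    exact this.trans (hpair _).le
  calc (n - 2 * r) * P ≤ Z.card * P := Nat.mul_le_mul_right _ hZc
    _ = ∑ z ∈ Z, P := by simp
    _ ≤ ∑ z ∈ Z, (S.filter (fun A => F z ∈ A)).card := Finset.sum_le_sum hle
    _ = ∑ A ∈ S, (Z.filter (fun z => F z ∈ A)).card :=
        Finset.sum_card_bipartiteAbove_eq_sum_card_bipartiteBelow (fun z A => F z ∈ A)
    _ ≤ ∑ A ∈ S, EH.card := by
        apply Finset.sum_le_sum
        intro A hA
        have hA' : A ∈ hypCopies EH n := by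
          have : A ∈ famAt (hypCopies EH n) e := by simpa [hS] using hA
          exact this.1
        rw [← hypCopies_card hA']
        apply Finset.card_le_card_of_injOn F
        · intro z hz
          exact (Finset.mem_filter.1 hz).2
        · intro z hz w hw h
          exact hFinj z (Finset.mem_filter.1 hz).1 w (Finset.mem_filter.1 hw).1 h
    _ = EH.card * (famAt (hypCopies EH n) e).ncard := by
        rw [hSc]; simp [mul_comm]

/-- A non-trivial intersecting family is small. -/
lemma nontrivial_bound {r : ℕ} {EH : Finset (Finset V)} (hEH : ∀ e ∈ EH, e.card = r) {n : ℕ}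
    {x : Finset (Fin n)} (hx : x.card = r)
    {B : Set (Finset (Finset (Fin n)))} (hB : B ⊆ hypCopies EH n)
    (hint : IsIntersectingFamily B)
    (hnt : ∀ e : Finset (Fin n), e.card = r → ¬ B ⊆ famAt (hypCopies EH n) e) :
    (n - 2 * r) * B.ncard ≤ EH.card ^ 3 * (famAt (hypCopies EH n) x).ncard := by
  classical
  have hex : ∀ e : Finset (Fin n), ∃ A ∈ B, e.card = r → e ∉ A := by
    have h0 := hnt x hx
    obtain ⟨A0, hA0, _⟩ := Set.not_subset.1 h0
    intro e
    by_cases he : e.card = r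
    · obtain ⟨A, hA, hA'⟩ := Set.not_subset.1 (hnt e he)
      exact ⟨A, hA, fun _ h => hA' ⟨hB hA, h⟩⟩
    · exact ⟨A0, hA0, fun h => absurd h he⟩
  choose T hTB hT using hex
  set A := T x with hA
  have hAB : A ∈ B := hTB x
  let I : Finset (Σ _ : Finset (Fin n), Finset (Fin n)) := A.sigma (fun e => T e)
  let G : (Σ _ : Finset (Fin n), Finset (Fin n)) → Set (Finset (Finset (Fin n))) := fun p =>
    famAt (hypCopies EH n) p.1 ∩ famAt (hypCopies EH n) p.2
  have hcov : B ⊆ ⋃ p ∈ I, G p := by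
    intro C hC
    obtain ⟨e, heC, heA⟩ := hint C hC A hAB
    obtain ⟨f, hfC, hfT⟩ := hint C hC (T e) (hTB e)
    simp only [Set.mem_iUnion]
    exact ⟨⟨e, f⟩, Finset.mem_sigma.2 ⟨heA, hfT⟩, ⟨hB hC, heC⟩, ⟨hB hC, hfC⟩⟩
  have hI : I.card = EH.card * EH.card := by
    rw [Finset.card_sigma, Finset.sum_congr rfl (fun e _ => hypCopies_card (hB (hTB e)))]
    simp [hypCopies_card (hB hAB)]
  have hBc : B.ncard ≤ ∑ p ∈ I, (G p).ncard :=
    (Set.ncard_le_ncard hcov (Set.toFinite _)).trans (Finset.set_ncard_biUnion_le I G)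
  calc (n - 2 * r) * B.ncard ≤ (n - 2 * r) * ∑ p ∈ I, (G p).ncard := Nat.mul_le_mul_left _ hBc
    _ = ∑ p ∈ I, (n - 2 * r) * (G p).ncard := Finset.mul_sum _ _ _
    _ ≤ ∑ p ∈ I, EH.card * (famAt (hypCopies EH n) x).ncard := by
        apply Finset.sum_le_sum
        rintro ⟨e, f⟩ hp
        obtain ⟨h1, h2⟩ := Finset.mem_sigma.1 hp
        have he : e.card = r := hypCopies_edge_card hEH (hB hAB) h1
        have hf : f.card = r := hypCopies_edge_card hEH (hB (hTB e)) h2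
        have hne : e ≠ f := by
          intro h
          exact hT e he (by rw [h] at h2 ⊢; exact h2)
        exact (famAt_pair EH he hf hne).trans
          (Nat.mul_le_mul_left _ (famAt_card_le EH (he.trans hx.symm)))
    _ = EH.card ^ 3 * (famAt (hypCopies EH n) x).ncard := by
        rw [Finset.sum_const, hI, smul_eq_mul]; ring

end EKRHelpers

/-- For every `r`-uniform hypergraph `H` (with finite vertex type `V` and hyperedge set `EH`,
all hyperedges of size `r`), there is a constant `n₀` such that for all `n ≥ n₀` the family of
all copies of `H` in the complete `r`-uniform hypergraph `K_n^{(r)}` (whose ground set is the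
set of all `r`-subsets of `Fin n`) is a strong EKR family. -/
theorem hypCopies_strongEKR {V : Type*} [Fintype V] [DecidableEq V]
    (r : ℕ) (EH : Finset (Finset V)) (hEH : ∀ e ∈ EH, e.card = r) :
    ∃ n₀ : ℕ, ∀ n : ℕ, n₀ ≤ n →
      IsStrongEKRFamily {e : Finset (Fin n) | e.card = r} (hypCopies EH n) := by
  refine ⟨2 * r + EH.card ^ 3 + 1 + Fintype.card V, fun n hn => ?_⟩
  obtain ⟨x0, -, hx0⟩ : ∃ x0 ⊆ (Finset.univ : Finset (Fin n)), x0.card = r :=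
    Finset.exists_subset_card_eq (by rw [Finset.card_univ, Fintype.card_fin]; omega)
  rcases EH.eq_empty_or_nonempty with rfl | ⟨e0, he0⟩
  · have hemp : ∀ ℬ ⊆ hypCopies (∅ : Finset (Finset V)) n, IsIntersectingFamily ℬ → ℬ = ∅ := by
      intro ℬ hℬ hint
      refine Set.eq_empty_of_forall_notMem fun A hA => ?_
      obtain ⟨y, hy, -⟩ := hint A hA A hA
      have := hypCopies_card (hℬ hA)
      rw [Finset.card_empty, Finset.card_eq_zero] at this
      simp [this] at hy
    have hint : ∀ y, IsIntersectingFamily (famAt (hypCopies (∅ : Finset (Finset V)) n) y) :=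
      fun y A hA B hB => ⟨y, hA.2, hB.2⟩
    refine ⟨fun x _ ℬ hℬ hi => ?_, fun ℬ hℬ hi _ => ⟨x0, hx0, ?_⟩⟩
    · rw [hemp ℬ hℬ hi]; simp
    · rw [hemp ℬ hℬ hi, hemp _ (fun A hA => hA.1) (hint x0)]
  have hpos : ∀ x : Finset (Fin n), x.card = r → 0 < (famAt (hypCopies EH n) x).ncard := by
    intro x hx
    obtain ⟨φ⟩ : Nonempty (V ↪ Fin n) :=
      Function.Embedding.nonempty_of_card_le (by rw [Fintype.card_fin]; omega)
    have hc : (e0.image φ).card = x.card := by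
      rw [Finset.card_image_of_injective _ φ.injective, hEH e0 he0, hx]
    refine lt_of_lt_of_le ?_ (famAt_card_le EH hc)
    rw [Set.ncard_pos (Set.toFinite _)]
    exact ⟨_, ⟨φ, φ.injective, rfl⟩, Finset.mem_image_of_mem _ he0⟩
  have hsmall : ∀ x : Finset (Fin n), x.card = r → ∀ ℬ ⊆ hypCopies EH n,
      IsIntersectingFamily ℬ →
      (∀ e : Finset (Fin n), e.card = r → ¬ ℬ ⊆ famAt (hypCopies EH n) e) →
      ℬ.ncard < (famAt (hypCopies EH n) x).ncard := by
    intro x hx ℬ hℬ hi hnt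
    have h1 := nontrivial_bound hEH hx hℬ hi hnt
    have h2 : EH.card ^ 3 < n - 2 * r := by omega
    exact Nat.lt_of_mul_lt_mul_left (h1.trans_lt (Nat.mul_lt_mul_of_pos_right h2 (hpos x hx)))
  refine ⟨fun x hx ℬ hℬ hi => ?_, fun ℬ hℬ hi hmax => ?_⟩
  · by_cases h : ∃ e : Finset (Fin n), e.card = r ∧ ℬ ⊆ famAt (hypCopies EH n) e
    · obtain ⟨e, he, hsub⟩ := h
      exact (Set.ncard_le_ncard hsub (Set.toFinite _)).trans
        (famAt_card_le EH (he.trans (Eq.symm hx)))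
    · push Not at h
      exact (hsmall x hx ℬ hℬ hi h).le
  · by_cases h : ∃ e : Finset (Fin n), e.card = r ∧ ℬ ⊆ famAt (hypCopies EH n) e
    · obtain ⟨e, he, hsub⟩ := h
      exact ⟨e, he, Set.eq_of_subset_of_ncard_le hsub
        (hmax _ (fun A hA => hA.1) (fun A hA B hB => ⟨e, hA.2, hB.2⟩)) (Set.toFinite _)⟩
    · push Not at h
      exact absurd (hmax _ (fun A hA => hA.1) (fun A hA B hB => ⟨x0, hA.2, hB.2⟩))
        (not_le.2 (hsmall x0 hx0 ℬ hℬ hi h))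
end

section
/- Let n and k be positive integers with n ≥ 2k. The family ℱ_n(T_k) of all k-matchings in the complete graph K_n (sets of k pairwise disjoint edges) is an EKR family. -/
/-- The family of all `k`-matchings of the complete graph `K_n`: sets of `k` pairwise
vertex-disjoint edges of `K_n`, each matching identified with its edge set. -/
def matchingFamily (n k : ℕ) : Set (Finset (Sym2 (Fin n))) :=
  {E | E.card = k ∧ (↑E : Set (Sym2 (Fin n))) ⊆ (⊤ : SimpleGraph (Fin n)).edgeSet ∧
      ∀ e ∈ E, ∀ f ∈ E, e ≠ f → ∀ v : Fin n, v ∈ e → v ∉ f}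


/-- `E` is a `k`-matching on the vertex type `V`. -/
def IsM {V : Type*} (k : ℕ) (E : Finset (Sym2 V)) : Prop :=
  E.card = k ∧ (∀ e ∈ E, ¬ e.IsDiag) ∧ ∀ e ∈ E, ∀ f ∈ E, e ≠ f → ∀ v : V, v ∈ e → v ∉ f

lemma mem_matchingFamily {n k : ℕ} (E : Finset (Sym2 (Fin n))) :
    E ∈ matchingFamily n k ↔ IsM k E := by
  unfold matchingFamily IsM
  simp only [Set.mem_ofPred_eq, SimpleGraph.edgeSet_top]
  rfl

lemma IsM.image {V W : Type*} [DecidableEq V] [DecidableEq W] {k : ℕ} {E : Finset (Sym2 V)}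
    (h : IsM k E) (g : V ≃ W) : IsM k (E.image (Sym2.map g)) := by
  obtain ⟨h1, h2, h3⟩ := h
  have hinj := Sym2.map.injective g.injective
  refine ⟨by rw [Finset.card_image_of_injective _ hinj, h1], ?_, ?_⟩
  · intro e he
    obtain ⟨e, he0, rfl⟩ := Finset.mem_image.1 he
    rw [Sym2.isDiag_map g.injective]
    exact h2 e he0
  · intro e he f hf hne v hv hv'
    obtain ⟨e, he0, rfl⟩ := Finset.mem_image.1 he
    obtain ⟨f, hf0, rfl⟩ := Finset.mem_image.1 hf
    obtain ⟨a, ha, rfl⟩ := Sym2.mem_map.1 hv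
    obtain ⟨b, hb, hab⟩ := Sym2.mem_map.1 hv'
    have : b = a := g.injective hab
    subst this
    exact h3 e he0 f hf0 (fun h => hne (by rw [h])) b ha hb

/-- A matching can be labelled. -/
lemma IsM.label {V : Type*} [DecidableEq V] {k : ℕ} {E : Finset (Sym2 V)} (h : IsM k E) :
    ∃ f : Fin k × Bool → V, Function.Injective f ∧
      E = Finset.univ.image (fun i : Fin k => s(f (i, false), f (i, true))) := by
  obtain ⟨h1, h2, h3⟩ := h
  let φ : Fin k ≃ E := (finCongr h1.symm).trans E.equivFin.symm
  let f : Fin k × Bool → V := fun x =>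
    if x.2 then (Quot.out (φ x.1).1).2 else (Quot.out (φ x.1).1).1
  have hf : ∀ i, s(f (i, false), f (i, true)) = (φ i).1 := by
    intro i
    simp only [f]
    exact Quot.out_eq (φ i).1
  have hmem : ∀ i b, f (i, b) ∈ (φ i).1 := by
    intro i b
    rw [← hf i]
    cases b <;> simp
  refine ⟨f, ?_, ?_⟩
  · rintro ⟨i, b⟩ ⟨j, c⟩ hij
    have hi : i = j := by
      by_contra hne
      have hne' : (φ i).1 ≠ (φ j).1 := fun h => hne (φ.injective (Subtype.ext h))
      refine h3 _ (φ i).2 _ (φ j).2 hne' (f (i, b)) (hmem i b) ?_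
      rw [hij]; exact hmem j c
    subst hi
    have hd := h2 _ (φ i).2
    rw [← hf i, Sym2.mk_isDiag_iff] at hd
    cases b <;> cases c <;> simp_all
  · ext e
    simp only [Finset.mem_image, Finset.mem_univ, true_and, hf]
    constructor
    · intro he
      exact ⟨φ.symm ⟨e, he⟩, by simp⟩
    · rintro ⟨i, rfl⟩
      exact (φ i).2

lemma IsM.transitive {V : Type*} [Fintype V] [DecidableEq V] {k : ℕ} {A B : Finset (Sym2 V)}
    (hA : IsM k A) (hB : IsM k B) : ∃ σ : Equiv.Perm V, A.image (Sym2.map σ) = B := by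
  obtain ⟨f, hf, rfl⟩ := hA.label
  obtain ⟨g, hg, rfl⟩ := hB.label
  obtain ⟨σ, hσ⟩ := Equiv.Perm.exists_extending_pair f g hf hg
  refine ⟨σ, ?_⟩
  rw [Finset.image_image]
  congr 1
  ext1 i
  simp [hσ]

open Classical in
/-- All `k`-matchings as a finset. -/
noncomputable def allM (n k : ℕ) : Finset (Finset (Sym2 (Fin n))) :=
  Finset.univ.filter (IsM k)

lemma mem_allM {n k : ℕ} {A : Finset (Sym2 (Fin n))} : A ∈ allM n k ↔ IsM k A := by
  simp [allM]

lemma image_trans {V W X : Type*} [DecidableEq V] [DecidableEq W] [DecidableEq X]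
    (g : V ≃ W) (h : W ≃ X) (A : Finset (Sym2 V)) :
    A.image (Sym2.map (g.trans h)) = (A.image (Sym2.map g)).image (Sym2.map h) := by
  rw [Finset.image_image, ← Sym2.map_comp]; rfl

/-- the number of equivalences carrying `A` to `B` -/
lemma card_carry {V : Type*} [Fintype V] [DecidableEq V] {n k : ℕ} {A : Finset (Sym2 V)}
    (hA : IsM k A) {B : Finset (Sym2 (Fin n))} (hB : IsM k B) :
    (allM n k).card * (Finset.univ.filter
      (fun g : V ≃ Fin n => A.image (Sym2.map g) = B)).card = Fintype.card (V ≃ Fin n) := by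
  have key : ∀ C ∈ allM n k, (Finset.univ.filter
      (fun g : V ≃ Fin n => A.image (Sym2.map g) = C)).card = (Finset.univ.filter
      (fun g : V ≃ Fin n => A.image (Sym2.map g) = B)).card := by
    intro C hC
    obtain ⟨σ, hσ⟩ := (mem_allM.1 hC).transitive hB
    refine Finset.card_bij' (fun g _ => g.trans σ) (fun g _ => g.trans σ.symm) ?_ ?_ ?_ ?_
    · intro g hg
      simp only [Finset.mem_filter, Finset.mem_univ, true_and] at hg ⊢
      rw [image_trans, hg, hσ]
    · intro g hg
      simp only [Finset.mem_filter, Finset.mem_univ, true_and] at hg ⊢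
      rw [image_trans, hg, ← hσ, ← image_trans]
      simp
    · intro g _; ext x; simp
    · intro g _; ext x; simp
  have := Finset.card_eq_sum_card_fiberwise (s := (Finset.univ : Finset (V ≃ Fin n)))
    (t := allM n k) (f := fun g : V ≃ Fin n => A.image (Sym2.map g))
    (fun g _ => mem_allM.2 (hA.image g))
  rw [Finset.sum_congr rfl key, Finset.sum_const, smul_eq_mul, Finset.card_univ] at this
  exact this.symm

lemma isM_one {V : Type*} {e : Sym2 V} (h : ¬ e.IsDiag) : IsM 1 {e} := by
  refine ⟨by simp, by simpa using h, ?_⟩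
  intro e he f hf hne
  simp only [Finset.mem_singleton] at he hf
  exact absurd (he.trans hf.symm) hne

lemma count_at {n k : ℕ} {e : Sym2 (Fin n)} (he : ¬ e.IsDiag) :
    (allM n k).card * k = n.choose 2 * ((allM n k).filter (fun A => e ∈ A)).card := by
  have h := Finset.sum_card_bipartiteAbove_eq_sum_card_bipartiteBelow
    (s := allM n k) (t := (⊤ : SimpleGraph (Fin n)).edgeFinset) (fun A f => f ∈ A)
  have h1 : ∀ A ∈ allM n k, (Finset.bipartiteAbove (fun (A : Finset (Sym2 (Fin n))) f => f ∈ A)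
      (⊤ : SimpleGraph (Fin n)).edgeFinset A).card = k := by
    intro A hA
    obtain ⟨a1, a2, a3⟩ := mem_allM.1 hA
    rw [← a1]
    congr 1
    ext f
    simp only [Finset.bipartiteAbove, Finset.mem_filter, SimpleGraph.mem_edgeFinset,
      SimpleGraph.edgeSet_top]
    exact ⟨fun h => h.2, fun h => ⟨a2 f h, h⟩⟩
  have h2 : ∀ f ∈ (⊤ : SimpleGraph (Fin n)).edgeFinset,
      (Finset.bipartiteBelow (fun (A : Finset (Sym2 (Fin n))) f => f ∈ A) (allM n k) f).card
        = ((allM n k).filter (fun A => e ∈ A)).card := by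
    intro f hf
    have hf' : ¬ f.IsDiag := by
      rw [SimpleGraph.mem_edgeFinset, SimpleGraph.edgeSet_top] at hf
      exact hf
    obtain ⟨σ, hσ⟩ := (isM_one hf').transitive (isM_one he)
    have hσ' : Sym2.map σ f = e := by simpa using hσ
    have hinv : Sym2.map σ.symm e = f := by
      rw [← hσ', Sym2.map_map]; simp
    refine Finset.card_bij' (fun A _ => A.image (Sym2.map σ))
      (fun A _ => A.image (Sym2.map σ.symm)) ?_ ?_ ?_ ?_
    · intro A hA
      simp only [Finset.bipartiteBelow, Finset.mem_filter] at hA ⊢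
      exact ⟨mem_allM.2 ((mem_allM.1 hA.1).image σ),
        Finset.mem_image.2 ⟨f, hA.2, hσ'⟩⟩
    · intro A hA
      simp only [Finset.bipartiteBelow, Finset.mem_filter] at hA ⊢
      exact ⟨mem_allM.2 ((mem_allM.1 hA.1).image σ.symm),
        Finset.mem_image.2 ⟨e, hA.2, hinv⟩⟩
    · intro A _
      simp only [← image_trans]; simp
    · intro A _
      simp only [← image_trans]; simp
  rw [Finset.sum_congr rfl h1, Finset.sum_congr rfl h2, Finset.sum_const, Finset.sum_const,
    SimpleGraph.card_edgeFinset_top_eq_card_choose_two, Fintype.card_fin] at h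
  simpa using h

/-- The averaging lemma. -/
lemma isEKR_of_structure {V : Type*} [Fintype V] [DecidableEq V] {n k r : ℕ}
    (hV : Fintype.card V = n) {I : Type*} [Fintype I] [Nonempty I]
    (φ : I → Finset (Sym2 V)) (hφ : ∀ i, IsM k (φ i))
    (hr : ∀ J : Finset I, (∀ i ∈ J, ∀ j ∈ J, ∃ x, x ∈ φ i ∧ x ∈ φ j) → J.card ≤ r)
    (hcount : r * n.choose 2 ≤ k * Fintype.card I) :
    IsEKRFamily (⊤ : SimpleGraph (Fin n)).edgeSet (matchingFamily n k) := by
  classical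
  intro e he ℬ hℬ hint
  have he' : ¬ e.IsDiag := by
    have h0 := he
    rw [SimpleGraph.edgeSet_top] at h0
    exact h0
  have hpos : 0 < n.choose 2 := by
    have : e ∈ (⊤ : SimpleGraph (Fin n)).edgeFinset := by
      rw [SimpleGraph.mem_edgeFinset]; exact he
    have := Finset.card_pos.2 ⟨e, this⟩
    rwa [SimpleGraph.card_edgeFinset_top_eq_card_choose_two, Fintype.card_fin] at this
  let B : Finset (Finset (Sym2 (Fin n))) := Finset.univ.filter (· ∈ ℬ)
  have hB : ℬ = (B : Set _) := by ext; simp [B]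
  have hF : famAt (matchingFamily n k) e = ((allM n k).filter (fun A => e ∈ A) : Finset _) := by
    ext A
    simp [famAt, mem_allM, mem_matchingFamily]
  rw [hF, hB, Set.ncard_coe_finset, Set.ncard_coe_finset]
  have hBM : ∀ A ∈ B, IsM k A := by
    intro A hA
    exact (mem_matchingFamily A).1 (hℬ (by simpa [B] using hA))
  -- double counting
  have hdc := Finset.sum_card_bipartiteAbove_eq_sum_card_bipartiteBelow
    (s := (Finset.univ : Finset (V ≃ Fin n))) (t := (Finset.univ : Finset I))
    (fun (g : V ≃ Fin n) i => (φ i).image (Sym2.map g) ∈ B)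
  have hle : ∀ g ∈ (Finset.univ : Finset (V ≃ Fin n)),
      (Finset.bipartiteAbove (fun (g : V ≃ Fin n) i => (φ i).image (Sym2.map g) ∈ B)
        Finset.univ g).card ≤ r := by
    intro g _
    apply hr
    intro i hi j hj
    simp only [Finset.bipartiteAbove, Finset.mem_filter, Finset.mem_univ, true_and] at hi hj
    obtain ⟨x, hx, hy⟩ := hint _ (by simpa [B] using hi) _ (by simpa [B] using hj)
    obtain ⟨a, ha, rfl⟩ := Finset.mem_image.1 hx
    obtain ⟨b, hb, hab⟩ := Finset.mem_image.1 hy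
    have := Sym2.map.injective g.injective hab
    subst this
    exact ⟨b, ha, hb⟩
  have heq : ∀ i ∈ (Finset.univ : Finset I), (allM n k).card *
      (Finset.bipartiteBelow (fun (g : V ≃ Fin n) i => (φ i).image (Sym2.map g) ∈ B)
        Finset.univ i).card = B.card * Fintype.card (V ≃ Fin n) := by
    intro i _
    have h1 := Finset.card_eq_sum_card_fiberwise (s := Finset.bipartiteBelow
      (fun (g : V ≃ Fin n) i => (φ i).image (Sym2.map g) ∈ B) Finset.univ i)
      (t := B) (f := fun g : V ≃ Fin n => (φ i).image (Sym2.map g))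
      (fun g hg => by simpa [Finset.bipartiteBelow] using hg)
    rw [h1, Finset.mul_sum]
    rw [Finset.sum_congr rfl (g := fun _ => Fintype.card (V ≃ Fin n))]
    · simp
    · intro C hC
      rw [← card_carry (hφ i) (hBM C hC)]
      congr 2
      ext g
      simp only [Finset.bipartiteBelow, Finset.mem_filter, Finset.mem_univ, true_and]
      exact ⟨fun h => h.2, fun h => ⟨h ▸ hC, h⟩⟩
  have hup := Finset.sum_le_card_nsmul _ _ r hle
  have hG : 0 < Fintype.card (V ≃ Fin n) := by
    have : Nonempty (V ≃ Fin n) := ⟨Fintype.equivFinOfCardEq hV⟩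
    exact Fintype.card_pos
  have hmain : Fintype.card I * B.card ≤ (allM n k).card * r := by
    apply Nat.le_of_mul_le_mul_right _ hG
    calc Fintype.card I * B.card * Fintype.card (V ≃ Fin n)
        = ∑ i : I, B.card * Fintype.card (V ≃ Fin n) := by simp [mul_assoc]
      _ = (allM n k).card * ∑ i : I, (Finset.bipartiteBelow
          (fun (g : V ≃ Fin n) i => (φ i).image (Sym2.map g) ∈ B) Finset.univ i).card := by
          rw [Finset.mul_sum]
          exact Finset.sum_congr rfl (fun i hi => (heq i hi).symm)
      _ ≤ (allM n k).card * (Fintype.card (V ≃ Fin n) * r) := by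
          apply Nat.mul_le_mul_left
          rw [← hdc]
          simpa using hup
      _ = _ := by ring
  have hI : 0 < Fintype.card I := Fintype.card_pos
  have hc := count_at (k := k) he'
  apply Nat.le_of_mul_le_mul_left _ (Nat.mul_pos hI hpos)
  calc Fintype.card I * n.choose 2 * B.card = (Fintype.card I * B.card) * n.choose 2 := by ring
    _ ≤ ((allM n k).card * r) * n.choose 2 := Nat.mul_le_mul_right _ hmain
    _ = (allM n k).card * (r * n.choose 2) := by ring
    _ ≤ (allM n k).card * (k * Fintype.card I) := Nat.mul_le_mul_left _ hcount
    _ = Fintype.card I * ((allM n k).card * k) := by ring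
    _ = _ := by rw [hc]; ring

/-- Katona's cycle argument. -/
lemma katona {N k : ℕ} [NeZero N] (h2 : 2 * k ≤ N) (J : Finset (ZMod N))
    (h : ∀ s ∈ J, ∀ t ∈ J, ∃ a < k, ∃ b < k, s + (a : ZMod N) = t + (b : ZMod N)) :
    J.card ≤ k := by
  rcases J.eq_empty_or_nonempty with rfl | ⟨t₀, ht₀⟩
  · simp
  have hN : 0 < N := NeZero.pos N
  -- relation between differences of values
  have hval : ∀ s ∈ J, ∃ a < k, ∃ b < k, (s - t₀).val + a = b ∨ (s - t₀).val + a = b + N := by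
    intro s hs
    obtain ⟨a, ha, b, hb, hab⟩ := h s hs t₀ ht₀
    refine ⟨a, ha, b, hb, ?_⟩
    have hlt := ZMod.val_lt (s - t₀)
    have h1 : (((s - t₀).val + a : ℕ) : ZMod N) = (b : ℕ) := by
      push_cast
      rw [ZMod.natCast_zmod_val]
      linear_combination hab
    rw [ZMod.natCast_eq_natCast_iff', Nat.mod_eq_of_lt (show b < N by omega)] at h1
    rcases lt_or_ge ((s - t₀).val + a) N with h3 | h3
    · left; rwa [Nat.mod_eq_of_lt h3] at h1
    · right
      rw [Nat.mod_eq_sub_mod h3, Nat.mod_eq_of_lt (by omega)] at h1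
      omega
  have hsep : ∀ s ∈ J, ∀ t ∈ J, (s - t₀).val + k ≠ (t - t₀).val + N := by
    intro s hs t ht hst
    obtain ⟨a, ha, b, hb, hab⟩ := h s hs t ht
    have h1 : (((s - t₀).val + k : ℕ) : ZMod N) = (((t - t₀).val + N : ℕ) : ZMod N) := by
      rw [hst]
    push_cast at h1
    rw [ZMod.natCast_zmod_val, ZMod.natCast_zmod_val, ZMod.natCast_self] at h1
    have h3 : ((k + b : ℕ) : ZMod N) = (a : ℕ) := by
      push_cast
      linear_combination h1 - hab
    rw [ZMod.natCast_eq_natCast_iff', Nat.mod_eq_of_lt (show k + b < N by omega),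
      Nat.mod_eq_of_lt (show a < N by omega)] at h3
    omega
  have := Finset.card_le_card_of_injOn (s := J) (t := Finset.range k)
    (fun s => if (s - t₀).val < k then (s - t₀).val else (s - t₀).val + k - N) ?_ ?_
  · simpa using this
  · intro s hs
    obtain ⟨a, ha, b, hb, hab⟩ := hval s hs
    have hlt := ZMod.val_lt (s - t₀)
    simp only [Finset.coe_range, Set.mem_Iio]
    split_ifs <;> omega
  · intro s hs t ht hst
    have hs' : s ∈ J := hs
    have ht' : t ∈ J := ht
    obtain ⟨a, ha, b, hb, hab⟩ := hval s hs'
    obtain ⟨c, hc, d, hd, hcd⟩ := hval t ht'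
    have e1 := hsep s hs' t ht'
    have e2 := hsep t ht' s hs'
    have heq : (s - t₀).val = (t - t₀).val := by
      simp only at hst
      split_ifs at hst <;> omega
    have := ZMod.val_injective N heq
    exact sub_left_injective this

/-- Abstract form of a 1-factorization with well-ordered factors. -/
lemma isEKR_of_blocks {V : Type*} [Fintype V] [DecidableEq V] {n k p L : ℕ} [NeZero p]
    (hV : Fintype.card V = n) (hk : 0 < k) (hkL : k ≤ L) (hp : k = L ∨ 2 ≤ p)
    (hN : n.choose 2 = p * L) (b : ZMod p → ℕ → Sym2 V)
    (H1 : ∀ i, ∀ j < L, ¬ (b i j).IsDiag)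
    (H2 : ∀ i i', ∀ j < L, ∀ j' < L, b i j = b i' j' → i = i' ∧ j = j')
    (H3 : ∀ i, ∀ j < L, ∀ j' < L, j ≠ j' → ∀ v, v ∈ b i j → v ∉ b i j')
    (H4 : ∀ i, ∀ j < L, ∀ j', j' + 2 ≤ j → ∀ v, v ∈ b i j → v ∉ b (i + 1) j') :
    IsEKRFamily (⊤ : SimpleGraph (Fin n)).edgeSet (matchingFamily n k) := by
  have hL : 0 < L := by omega
  rcases Nat.lt_or_ge k L with hlt | hge
  swap
  · have hkL' : k = L := le_antisymm hkL hge
    subst hkL'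
    refine isEKR_of_structure (r := 1) hV
      (fun i : ZMod p => (Finset.range k).image (b i)) ?_ ?_ ?_
    · intro i
      refine ⟨?_, ?_, ?_⟩
      · rw [Finset.card_image_of_injOn, Finset.card_range]
        intro j hj j' hj' h
        exact (H2 i i j (by simpa using hj) j' (by simpa using hj') h).2
      · intro e he
        obtain ⟨j, hj, rfl⟩ := Finset.mem_image.1 he
        exact H1 i j (by simpa using hj)
      · intro e he f hf hne
        obtain ⟨j, hj, rfl⟩ := Finset.mem_image.1 he
        obtain ⟨j', hj', rfl⟩ := Finset.mem_image.1 hf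
        exact H3 i j (by simpa using hj) j' (by simpa using hj') (fun h => hne (by rw [h]))
    · intro J hJ
      rw [Finset.card_le_one]
      intro i hi i' hi'
      obtain ⟨x, hx, hx'⟩ := hJ i hi i' hi'
      obtain ⟨j, hj, rfl⟩ := Finset.mem_image.1 hx
      obtain ⟨j', hj', h⟩ := Finset.mem_image.1 hx'
      exact (H2 i' i j' (by simpa using hj') j (by simpa using hj) h).1.symm
    · rw [ZMod.card, hN]
      apply le_of_eq; ring
  · have hp2 : 2 ≤ p := by omega
    have hNpos : NeZero (p * L) := ⟨by positivity⟩
    have h2k : 2 * k ≤ p * L := Nat.mul_le_mul hp2 hkL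
    let e : ℕ → Sym2 V := fun t => b ((t / L : ℕ) : ZMod p) (t % L)
    have hmod : ∀ t, t % L < L := fun t => Nat.mod_lt _ hL
    have e1 : ∀ t, ¬ (e t).IsDiag := fun t => H1 _ _ (hmod t)
    have e2 : ∀ s t, e s = e t → ((s : ℕ) : ZMod (p * L)) = (t : ℕ) := by
      intro s t h
      obtain ⟨h1, h2⟩ := H2 _ _ _ (hmod s) _ (hmod t) h
      rw [ZMod.natCast_eq_natCast_iff] at h1 ⊢
      have h3 := (Nat.ModEq.mul_right' L h1).add_right (s % L)
      have h4 : s / L * L + s % L = s := Nat.div_add_mod' s L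
      have h5 : t / L * L + s % L = t := by rw [h2]; exact Nat.div_add_mod' t L
      rwa [h4, h5] at h3
    have e3 : ∀ t d, 0 < d → d < k → ∀ v, v ∈ e t → v ∉ e (t + d) := by
      intro t d hd hdk
      have hm := hmod t
      rcases lt_or_ge (t % L + d) L with h | h
      · have hdiv : (t + d) / L = t / L := by
          rw [Nat.add_div hL, Nat.div_eq_of_lt (show d < L by omega),
            Nat.mod_eq_of_lt (show d < L by omega), if_neg (by omega)]; omega
        have hmd : (t + d) % L = t % L + d := by
          rw [Nat.add_mod, Nat.mod_eq_of_lt (show d < L by omega), Nat.mod_eq_of_lt h]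
        simp only [e, hdiv, hmd]
        exact H3 _ _ hm _ h (by omega)
      · have hdiv : (t + d) / L = t / L + 1 := by
          rw [Nat.add_div hL, Nat.div_eq_of_lt (show d < L by omega),
            Nat.mod_eq_of_lt (show d < L by omega), if_pos (by omega)]
        have hmd : (t + d) % L = t % L + d - L := by
          rw [Nat.add_mod, Nat.mod_eq_of_lt (show d < L by omega), Nat.mod_eq_sub_mod h,
            Nat.mod_eq_of_lt (by omega)]
        simp only [e, hdiv, hmd]
        push_cast
        exact H4 _ _ hm _ (by omega)
    refine isEKR_of_structure (r := k) hV
      (fun t : ZMod (p * L) => (Finset.range k).image (fun a => e (t.val + a))) ?_ ?_ ?_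
    · intro t
      refine ⟨?_, ?_, ?_⟩
      · rw [Finset.card_image_of_injOn, Finset.card_range]
        intro a ha a' ha' h
        have ha1 : a < k := by simpa using ha
        have ha2 : a' < k := by simpa using ha'
        have h := e2 _ _ h
        push_cast at h
        have h := add_left_cancel h
        rw [ZMod.natCast_eq_natCast_iff', Nat.mod_eq_of_lt (show a < p * L by omega),
          Nat.mod_eq_of_lt (show a' < p * L by omega)] at h
        exact h
      · intro x hx
        obtain ⟨j, hj, rfl⟩ := Finset.mem_image.1 hx
        exact e1 _
      · intro x hx f hf hne v hv hv'
        obtain ⟨j, hj, rfl⟩ := Finset.mem_image.1 hx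
        obtain ⟨j', hj', rfl⟩ := Finset.mem_image.1 hf
        simp only [Finset.mem_range] at hj hj'
        rcases lt_trichotomy j j' with h | h | h
        · obtain ⟨d, rfl⟩ := Nat.exists_eq_add_of_lt h
          refine e3 _ (d + 1) (by omega) (by omega) v hv ?_
          convert! hv' using 2
          omega
        · exact hne (by rw [h])
        · obtain ⟨d, rfl⟩ := Nat.exists_eq_add_of_lt h
          refine e3 _ (d + 1) (by omega) (by omega) v hv' ?_
          convert! hv using 2
          omega
    · intro J hJ
      apply katona h2k
      intro s hs t ht
      obtain ⟨x, hx, hx'⟩ := hJ s hs t ht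
      obtain ⟨a, ha, rfl⟩ := Finset.mem_image.1 hx
      obtain ⟨c, hc, h⟩ := Finset.mem_image.1 hx'
      refine ⟨a, by simpa using ha, c, by simpa using hc, ?_⟩
      have h := e2 _ _ h.symm
      push_cast at h
      simpa using h
    · rw [ZMod.card, hN]

lemma cast_ne {p x : ℕ} (h0 : 0 < x) (h1 : x < p) : (x : ZMod p) ≠ 0 := by
  intro h
  rw [ZMod.natCast_eq_zero_iff] at h
  exact absurd (Nat.le_of_dvd h0 h) (by omega)

section core
variable {q : ℕ}

lemma core1 (i : ZMod (2 * q + 1)) {j : ℕ} (h0 : 1 ≤ j) (h1 : j ≤ q) :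
    i + (j : ZMod (2 * q + 1)) ≠ i - j := by
  intro h
  refine cast_ne (p := 2 * q + 1) (x := 2 * j) (by omega) (by omega) ?_
  push_cast; linear_combination h

lemma core3 (i : ZMod (2 * q + 1)) {j j' : ℕ} (h0 : 1 ≤ j) (h1 : j ≤ q) (h0' : 1 ≤ j')
    (h1' : j' ≤ q) (hne : j ≠ j') (v : ZMod (2 * q + 1))
    (hv : v = i + j ∨ v = i - j) (hv' : v = i + j' ∨ v = i - j') : False := by
  have hs := cast_ne (p := 2 * q + 1) (x := j + j') (by omega) (by omega)
  push_cast at hs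
  have hd : (j : ZMod (2 * q + 1)) ≠ j' := by
    intro h
    rw [ZMod.natCast_eq_natCast_iff', Nat.mod_eq_of_lt (by omega),
      Nat.mod_eq_of_lt (by omega)] at h
    exact hne h
  rcases hv with rfl | rfl <;> rcases hv' with h | h
  · exact hd (by linear_combination h)
  · exact hs (by linear_combination h)
  · exact hs (by linear_combination -h)
  · exact hd (by linear_combination -h)

lemma core2 (i i' : ZMod (2 * q + 1)) {j j' : ℕ} (h0 : 1 ≤ j) (h1 : j ≤ q) (h0' : 1 ≤ j')
    (h1' : j' ≤ q)
    (h : (i + (j : ZMod (2 * q + 1)) = i' + j' ∧ i - (j : ZMod (2 * q + 1)) = i' - j') ∨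
      (i + (j : ZMod (2 * q + 1)) = i' - j' ∧ i - (j : ZMod (2 * q + 1)) = i' + j')) :
    i = i' ∧ j = j' := by
  have h2 : (2 : ZMod (2 * q + 1)) * (-q) = 1 := by
    have := ZMod.natCast_self (2 * q + 1)
    push_cast at this
    linear_combination -this
  have hi : i = i' := by
    have h3 : 2 * i = 2 * i' := by
      rcases h with ⟨ha, hb⟩ | ⟨ha, hb⟩ <;> linear_combination ha + hb
    linear_combination (-(q : ZMod (2 * q + 1))) * h3 - (i - i') * h2
  refine ⟨hi, ?_⟩
  subst hi
  by_contra hne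
  refine core3 i h0 h1 h0' h1' hne (i + j) (Or.inl rfl) ?_
  rcases h with ⟨ha, _⟩ | ⟨ha, _⟩
  · exact Or.inl ha
  · exact Or.inr ha

lemma core4 (i : ZMod (2 * q + 1)) {j j' : ℕ} (h1 : j ≤ q)
    (hlt : j' + 2 ≤ j) (v : ZMod (2 * q + 1))
    (hv : v = i + j ∨ v = i - j) (hv' : v = i + 1 + j' ∨ v = i + 1 - j') : False := by
  obtain ⟨d, rfl⟩ := Nat.exists_eq_add_of_le hlt
  have a1 := cast_ne (p := 2 * q + 1) (x := d + 1) (by omega) (by omega)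
  have a2 := cast_ne (p := 2 * q + 1) (x := 2 * j' + d + 1) (by omega) (by omega)
  have a3 := cast_ne (p := 2 * q + 1) (x := 2 * j' + d + 3) (by omega) (by omega)
  have a4 := cast_ne (p := 2 * q + 1) (x := d + 3) (by omega) (by omega)
  push_cast at a1 a2 a3 a4 hv
  rcases hv with rfl | rfl <;> rcases hv' with h | h
  · exact a1 (by linear_combination h)
  · exact a2 (by linear_combination h)
  · exact a3 (by linear_combination -h)
  · exact a4 (by linear_combination -h)

end core

lemma odd_case (q k : ℕ) (hk : 0 < k) (hkq : k ≤ q) :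
    IsEKRFamily (⊤ : SimpleGraph (Fin (2 * q + 1))).edgeSet (matchingFamily (2 * q + 1) k) := by
  refine isEKR_of_blocks (V := ZMod (2 * q + 1)) (p := 2 * q + 1) (L := q) (ZMod.card _) hk hkq
    (Or.inr (by omega)) ?_
    (fun i j => s(i + ((j + 1 : ℕ) : ZMod (2 * q + 1)), i - ((j + 1 : ℕ) : ZMod (2 * q + 1))))
    ?_ ?_ ?_ ?_
  · rw [Nat.choose_two_right, Nat.add_sub_cancel,
      show (2 * q + 1) * (2 * q) = ((2 * q + 1) * q) * 2 by ring, Nat.mul_div_cancel _ (by omega)]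
  · intro i j hj
    rw [Sym2.mk_isDiag_iff]
    exact core1 i (by omega) (by omega)
  · intro i i' j hj j' hj' h
    rw [Sym2.eq_iff] at h
    have := core2 i i' (by omega) (by omega) (by omega) (by omega) h
    exact ⟨this.1, by omega⟩
  · intro i j hj j' hj' hne v hv hv'
    rw [Sym2.mem_iff] at hv hv'
    exact core3 i (by omega) (by omega) (by omega) (by omega) (by omega) v hv hv'
  · intro i j hj j' hlt v hv hv'
    rw [Sym2.mem_iff] at hv hv'
    exact core4 i (by omega) (by omega) v hv hv'

lemma even_case (q k : ℕ) (hk : 0 < k) (hkq : k ≤ q + 1) :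
    IsEKRFamily (⊤ : SimpleGraph (Fin (2 * q + 2))).edgeSet (matchingFamily (2 * q + 2) k) := by
  refine isEKR_of_blocks (V := Option (ZMod (2 * q + 1))) (p := 2 * q + 1) (L := q + 1)
    (by rw [Fintype.card_option, ZMod.card]) hk hkq (by omega) ?_
    (fun i j => if j = 0 then s(none, some i) else
      s(some (i + (j : ZMod (2 * q + 1))), some (i - (j : ZMod (2 * q + 1)))))
    ?_ ?_ ?_ ?_
  · rw [Nat.choose_two_right, show 2 * q + 2 - 1 = 2 * q + 1 by omega,
      show (2 * q + 2) * (2 * q + 1) = ((2 * q + 1) * (q + 1)) * 2 by ring,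
      Nat.mul_div_cancel _ (by omega)]
  · intro i j hj
    by_cases h : j = 0
    · simp [h]
    · simp only [h, if_false, Sym2.mk_isDiag_iff, Option.some.injEq]
      exact core1 i (by omega) (by omega)
  · intro i i' j hj j' hj' h
    by_cases h0 : j = 0 <;> by_cases h0' : j' = 0
    · subst h0 h0'
      simpa using h
    · simp [h0, h0'] at h
    · simp [h0, h0'] at h
    · simp only [h0, h0', if_false, Sym2.eq_iff, Option.some.injEq] at h
      exact core2 i i' (by omega) (by omega) (by omega) (by omega) h
  · intro i j hj j' hj' hne v hv hv'
    by_cases h0 : j = 0 <;> by_cases h0' : j' = 0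
    · omega
    · simp only [h0, h0', if_false, if_true, Sym2.mem_iff] at hv hv'
      have h5 := cast_ne (p := 2 * q + 1) (x := j') (by omega) (by omega)
      rcases hv with rfl | rfl <;> simp_all
      exact h5 (by linear_combination hv')
    · simp only [h0, h0', if_false, if_true, Sym2.mem_iff] at hv hv'
      have h5 := cast_ne (p := 2 * q + 1) (x := j) (by omega) (by omega)
      rcases hv' with rfl | rfl <;> simp_all
      exact h5 (by linear_combination hv)
    · simp only [h0, h0', if_false, Sym2.mem_iff] at hv hv'
      cases v with
      | none => simp at hv
      | some v =>
        simp only [Option.some.injEq] at hv hv'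
        exact core3 i (by omega) (by omega) (by omega) (by omega) hne v hv hv'
  · intro i j hj j' hlt v hv hv'
    have h0 : j ≠ 0 := by omega
    simp only [h0, if_false, Sym2.mem_iff] at hv
    cases v with
    | none => simp at hv
    | some v =>
      simp only [Option.some.injEq] at hv
      refine core4 i (by omega) hlt v hv ?_
      by_cases h0' : j' = 0
      · subst h0'
        simpa using hv'
      · simp only [h0', if_false] at hv'
        simpa using hv'

/-- For all positive integers `n` and `k` with `n ≥ 2k`, the family of all `k`-matchings of
the complete graph `K_n` is an EKR family. -/
theorem matchings_isEKR (n k : ℕ) (hk : 0 < k) (hn : 2 * k ≤ n) :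
    IsEKRFamily (⊤ : SimpleGraph (Fin n)).edgeSet (matchingFamily n k) := by
  rcases Nat.even_or_odd' n with ⟨m, rfl | rfl⟩
  · obtain ⟨q, rfl⟩ : ∃ q, m = q + 1 := ⟨m - 1, by omega⟩
    exact even_case q k hk (by omega)
  · exact odd_case m k hk (by omega)
end

section
/- Let n and k be positive integers with n ≥ k. The family ℬ_n(T_k) of all k-matchings in the complete bipartite graph K_{n,n} (sets of k pairwise disjoint edges) is an EKR family. -/
/-- The family of all `k`-matchings of the complete bipartite graph `K_{n,n}`: sets of `k`
pairwise vertex-disjoint edges of `K_{n,n}`, each matching identified with its edge set. -/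
def bipMatchingFamily (n k : ℕ) : Set (Finset (Sym2 (Fin n ⊕ Fin n))) :=
  {E | E.card = k ∧
      (↑E : Set (Sym2 (Fin n ⊕ Fin n))) ⊆ (completeBipartiteGraph (Fin n) (Fin n)).edgeSet ∧
      ∀ e ∈ E, ∀ f ∈ E, e ≠ f → ∀ v : Fin n ⊕ Fin n, v ∈ e → v ∉ f}

section EKRHelpers

open Finset

/-- The edge of `K_{n,n}` joining `x` on the left and `y` on the right. -/
def bedge {n : ℕ} (p : Fin n × Fin n) : Sym2 (Fin n ⊕ Fin n) := s(Sum.inl p.1, Sum.inr p.2)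

lemma bedge_inj {n : ℕ} : Function.Injective (bedge (n := n)) := by
  rintro ⟨a, b⟩ ⟨c, d⟩ h
  simpa [bedge] using h

lemma mem_edgeSet_iff {n : ℕ} (e : Sym2 (Fin n ⊕ Fin n)) :
    e ∈ (completeBipartiteGraph (Fin n) (Fin n)).edgeSet ↔ ∃ p, bedge p = e := by
  induction e using Sym2.ind with
  | _ u v =>
    rcases u with u | u <;> rcases v with v | v <;>
      simp [bedge, completeBipartiteGraph]

/-- The edge set of the matching given by two injections. -/
def mtch {n k : ℕ} (a b : Fin k → Fin n) : Finset (Sym2 (Fin n ⊕ Fin n)) :=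
  univ.image fun j => bedge (a j, b j)

lemma mem_mtch {n k : ℕ} (a b : Fin k → Fin n) (p : Fin n × Fin n) :
    bedge p ∈ mtch a b ↔ ∃ j, a j = p.1 ∧ b j = p.2 := by
  simp only [mtch, mem_image, mem_univ, true_and, bedge_inj.eq_iff, Prod.ext_iff]

lemma mtch_mem {n k : ℕ} (a b : Fin k → Fin n) (ha : a.Injective) (hb : b.Injective) :
    mtch a b ∈ bipMatchingFamily n k := by
  refine ⟨?_, ?_, ?_⟩
  · rw [mtch, card_image_of_injective]
    · simp
    · intro i j h
      have := bedge_inj h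
      simp only [Prod.mk.injEq] at this
      exact ha this.1
  · intro e he
    simp only [mtch, coe_image, coe_univ, Set.image_univ, Set.mem_range] at he
    obtain ⟨j, rfl⟩ := he
    exact (mem_edgeSet_iff _).2 ⟨_, rfl⟩
  · intro e he f hf hne v hv hv'
    simp only [mtch, mem_image, mem_univ, true_and] at he hf
    obtain ⟨i, rfl⟩ := he
    obtain ⟨j, rfl⟩ := hf
    apply hne
    have : i = j := by
      rcases v with v | v
      · simp [bedge] at hv hv'
        exact ha (hv.symm.trans hv')
      · simp [bedge] at hv hv'
        exact hb (hv.symm.trans hv')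
    rw [this]

lemma exists_mtch {n k : ℕ} (E) (hE : E ∈ bipMatchingFamily n k) :
    ∃ a b : Fin k → Fin n, a.Injective ∧ b.Injective ∧ mtch a b = E := by
  obtain ⟨hc, hs, hd⟩ := hE
  have e : Fin k ≃ E := (Fintype.equivFinOfCardEq (by simpa using hc)).symm
  have : ∀ j, ∃ p, bedge p = (e j : Sym2 (Fin n ⊕ Fin n)) := fun j =>
    (mem_edgeSet_iff _).1 (hs (e j).2)
  choose p hp using this
  have key : ∀ i j, ∀ v, v ∈ bedge (p i) → v ∈ bedge (p j) → i = j := by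
    intro i j v hi hj
    by_contra hij
    rw [hp] at hi hj
    refine hd _ (e i).2 _ (e j).2 ?_ v hi hj
    intro h
    exact hij (e.injective (Subtype.ext h))
  refine ⟨fun j => (p j).1, fun j => (p j).2, ?_, ?_, ?_⟩
  · intro i j h
    refine key i j (Sum.inl (p i).1) (by simp [bedge]) ?_
    simp only at h
    simp [bedge, h]
  · intro i j h
    refine key i j (Sum.inr (p i).2) (by simp [bedge]) ?_
    simp only at h
    simp [bedge, h]
  · ext x
    simp only [mtch, mem_image, mem_univ, true_and, Prod.mk.eta, hp]
    constructor
    · rintro ⟨j, rfl⟩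
      exact (e j).2
    · intro hx
      exact ⟨e.symm ⟨x, hx⟩, by simp⟩

lemma exists_perm {n k : ℕ} (a b : Fin k → Fin n) (ha : a.Injective) (hb : b.Injective) :
    ∃ g : Equiv.Perm (Fin n), ∀ j, g (a j) = b j := by
  obtain ⟨g, hg⟩ := (Equiv.Perm.isMultiplyPretransitive (Fin n) k).exists_smul_eq
    (⟨a, ha⟩ : Fin k ↪ Fin n) ⟨b, hb⟩
  exact ⟨g, fun j => DFunLike.congr_fun hg j⟩

/-- The matching attached to a pair of permutations. -/
def phi {n k : ℕ} (hn : k ≤ n) (g : Equiv.Perm (Fin n) × Equiv.Perm (Fin n)) :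
    Finset (Sym2 (Fin n ⊕ Fin n)) :=
  mtch (fun j : Fin k => g.1 (Fin.castLE hn j)) (fun j => g.2 (Fin.castLE hn j))

/-- Action of a pair of permutations on matchings. -/
def act {n : ℕ} (g : Equiv.Perm (Fin n) × Equiv.Perm (Fin n))
    (E : Finset (Sym2 (Fin n ⊕ Fin n))) : Finset (Sym2 (Fin n ⊕ Fin n)) :=
  E.image (Sym2.map (Sum.map g.1 g.2))

lemma act_mtch {n k : ℕ} (g : Equiv.Perm (Fin n) × Equiv.Perm (Fin n)) (a b : Fin k → Fin n) :
    act g (mtch a b) = mtch (fun j => g.1 (a j)) (fun j => g.2 (b j)) := by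
  simp only [act, mtch, image_image]
  congr 1

lemma act_act {n : ℕ} (g h : Equiv.Perm (Fin n) × Equiv.Perm (Fin n))
    (E : Finset (Sym2 (Fin n ⊕ Fin n))) : act g (act h E) = act (g * h) E := by
  simp only [act, image_image]
  congr 1
  ext x
  induction x using Sym2.ind with
  | _ u v => rcases u with u | u <;> rcases v with v | v <;> simp

lemma act_one {n : ℕ} (E : Finset (Sym2 (Fin n ⊕ Fin n))) : act 1 E = E := by
  have : (Sym2.map (Sum.map (1 : Equiv.Perm (Fin n)) (1 : Equiv.Perm (Fin n)))) = id := by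
    ext x
    induction x using Sym2.ind with
    | _ u v => rcases u with u | u <;> rcases v with v | v <;> simp
  simp only [act, Prod.fst_one, Prod.snd_one, this, image_id]

lemma phi_mul {n k : ℕ} (hn : k ≤ n) (g h) : phi hn (g * h) = act g (phi hn h) := by
  rw [phi, phi, act_mtch]
  rfl

lemma exists_phi {n k : ℕ} (hn : k ≤ n) (a b : Fin k → Fin n) (ha : a.Injective)
    (hb : b.Injective) : ∃ g, phi hn g = mtch a b := by
  obtain ⟨g, hg⟩ := exists_perm (Fin.castLE hn) a (Fin.castLE_injective hn) ha
  obtain ⟨h, hh⟩ := exists_perm (Fin.castLE hn) b (Fin.castLE_injective hn) hb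
  exact ⟨(g, h), by simp [phi, hg, hh]⟩

/-- All fibres of `phi` over the family have the same size. -/
lemma fibre_eq {n k : ℕ} (hn : k ≤ n) (A B) (hA : A ∈ bipMatchingFamily n k)
    (hB : B ∈ bipMatchingFamily n k) :
    #{g | phi hn g = A} = #{g | phi hn g = B} := by
  obtain ⟨a, b, ha, hb, rfl⟩ := exists_mtch A hA
  obtain ⟨c, d, hc, hd, rfl⟩ := exists_mtch B hB
  obtain ⟨g, hg⟩ := exists_phi hn a b ha hb
  obtain ⟨h, hh⟩ := exists_phi hn c d hc hd
  rw [← hg, ← hh]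
  refine card_bij (fun x _ => (h * g⁻¹) * x) ?_ ?_ ?_
  · intro x hx
    simp only [mem_filter, mem_univ, true_and] at hx ⊢
    rw [phi_mul, hx, ← phi_mul]
    simp
  · intro x _ y _ hxy
    exact mul_left_cancel hxy
  · intro y hy
    simp only [mem_filter, mem_univ, true_and] at hy
    refine ⟨(h * g⁻¹)⁻¹ * y, ?_, mul_inv_cancel_left _ _⟩
    simp only [mem_filter, mem_univ, true_and]
    rw [phi_mul, hy, ← phi_mul]
    simp

lemma ekr_key {n k : ℕ} (hn : k ≤ n) {ι : Type} [Fintype ι] [Nonempty ι]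
    (a b : ι → Fin k → Fin n) (ha : ∀ t, (a t).Injective) (hb : ∀ t, (b t).Injective) (c : ℕ)
    (hle : ∀ T : Finset ι, (∀ s ∈ T, ∀ t ∈ T, ∃ i j, a s i = a t j ∧ b s i = b t j) → #T ≤ c)
    (hge : ∀ x y, ∃ T : Finset ι, c ≤ #T ∧ ∀ t ∈ T, ∃ j, a t j = x ∧ b t j = y) :
    IsEKRFamily (completeBipartiteGraph (Fin n) (Fin n)).edgeSet (bipMatchingFamily n k) := by
  classical
  intro x hx ℬ hℬ hI
  obtain ⟨p, rfl⟩ := (mem_edgeSet_iff x).1 hx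
  set 𝒮 := famAt (bipMatchingFamily n k) (bedge p) with h𝒮
  have h𝒮s : 𝒮 ⊆ bipMatchingFamily n k := fun A hA => hA.1
  -- pointwise comparison
  have hpt : ∀ g, #{t : ι | act g (mtch (a t) (b t)) ∈ ℬ} ≤
      #{t : ι | act g (mtch (a t) (b t)) ∈ 𝒮} := by
    intro g
    trans c
    · apply hle
      intro s hs t ht
      simp only [mem_filter, mem_univ, true_and] at hs ht
      obtain ⟨e, he, he'⟩ := hI _ hs _ ht
      rw [act_mtch] at he he'
      obtain ⟨q, rfl⟩ := (mem_edgeSet_iff e).1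
        ((mtch_mem _ _ (g.1.injective.comp (ha s)) (g.2.injective.comp (hb s))).2.1 he)
      obtain ⟨i, h1, h2⟩ := (mem_mtch _ _ _).1 he
      obtain ⟨j, h3, h4⟩ := (mem_mtch _ _ _).1 he'
      exact ⟨i, j, g.1.injective (h1.trans h3.symm), g.2.injective (h2.trans h4.symm)⟩
    · obtain ⟨T, hT, hT'⟩ := hge (g.1⁻¹ p.1) (g.2⁻¹ p.2)
      refine hT.trans (card_le_card ?_)
      intro t ht
      simp only [mem_filter, mem_univ, true_and]
      rw [act_mtch]
      refine ⟨mtch_mem _ _ (g.1.injective.comp (ha t)) (g.2.injective.comp (hb t)), ?_⟩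
      rw [mem_mtch]
      obtain ⟨j, h1, h2⟩ := hT' t ht
      exact ⟨j, by simp [h1], by simp [h2]⟩
  -- counting by `t`
  have hcount : ∀ 𝒞 : Set (Finset (Sym2 (Fin n ⊕ Fin n))),
      ∑ g, #{t : ι | act g (mtch (a t) (b t)) ∈ 𝒞} = Fintype.card ι * #{g | phi hn g ∈ 𝒞} := by
    intro 𝒞
    simp only [card_filter]
    rw [sum_comm]
    have : ∀ t : ι, (∑ g, if act g (mtch (a t) (b t)) ∈ 𝒞 then 1 else 0) =
        ∑ g, if phi hn g ∈ 𝒞 then 1 else 0 := by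
      intro t
      obtain ⟨h, hh⟩ := exists_phi hn (a t) (b t) (ha t) (hb t)
      rw [← hh]
      simp only [← phi_mul]
      exact Equiv.sum_comp (Equiv.mulRight h) (fun g => if phi hn g ∈ 𝒞 then 1 else 0)
    simp [this]
  have h1 : #{g | phi hn g ∈ ℬ} ≤ #{g | phi hn g ∈ 𝒮} := by
    have := sum_le_sum (s := univ) fun g _ => hpt g
    rw [hcount, hcount] at this
    exact Nat.le_of_mul_le_mul_left this Fintype.card_pos
  -- fibres
  obtain ⟨t⟩ := ‹Nonempty ι›
  have hM := mtch_mem _ _ (ha t) (hb t)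
  have hfib : ∀ 𝒞 ⊆ bipMatchingFamily n k,
      #{g | phi hn g ∈ 𝒞} = 𝒞.ncard * #{g | phi hn g = mtch (a t) (b t)} := by
    intro 𝒞 h𝒞
    rw [Set.ncard_eq_toFinset_card' 𝒞]
    rw [card_eq_sum_card_fiberwise (f := phi hn) (t := 𝒞.toFinset)
      (fun g hg => by simpa using hg)]
    rw [sum_const_nat (m := #{g | phi hn g = mtch (a t) (b t)})]
    intro A hA
    have hA' : A ∈ 𝒞 := by simpa using hA
    rw [← fibre_eq hn A _ (h𝒞 hA') hM]
    congr 1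
    ext g
    simp only [mem_filter, mem_univ, true_and]
    exact ⟨fun h => h.2, fun h => ⟨h ▸ hA', h⟩⟩
  rw [hfib _ hℬ, hfib _ h𝒮s] at h1
  refine Nat.le_of_mul_le_mul_right h1 ?_
  obtain ⟨h, hh⟩ := exists_phi hn (a t) (b t) (ha t) (hb t)
  exact card_pos.2 ⟨h, by simp [hh]⟩

/-- The case of perfect matchings. -/
lemma ekr_perfect (n : ℕ) (hn : 0 < n) :
    IsEKRFamily (completeBipartiteGraph (Fin n) (Fin n)).edgeSet (bipMatchingFamily n n) := by
  haveI : NeZero n := ⟨hn.ne'⟩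
  refine ekr_key le_rfl (ι := Fin n) (fun _ j => j) (fun t j => j + t) ?_ ?_ 1 ?_ ?_
  · exact fun t i j h => h
  · exact fun t i j h => by simpa using h
  · intro T hT
    rw [card_le_one]
    intro s hs t ht
    obtain ⟨i, j, h1, h2⟩ := hT s hs t ht
    subst h1
    simpa using h2
  · intro x y
    exact ⟨{y - x}, by simp, fun t ht => ⟨x, rfl, by simp at ht; simp [ht]⟩⟩

lemma arcs_le (m k : ℕ) (hm : 2 * k ≤ m) (T : Finset (Fin m))
    (hT : ∀ s ∈ T, ∀ t ∈ T, ∃ i j : Fin k, (s.1 + i.1) % m = (t.1 + j.1) % m) : #T ≤ k := by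
  rcases T.eq_empty_or_nonempty with rfl | ⟨z, hz⟩
  · simp
  have hT' : ∀ s ∈ T, ∀ t ∈ T, ∃ i j : ℕ, i < k ∧ j < k ∧
      (s.1 + i = t.1 + j ∨ s.1 + i + m = t.1 + j ∨ s.1 + i = t.1 + j + m) := by
    intro s hs t ht
    obtain ⟨i, j, h⟩ := hT s hs t ht
    refine ⟨i, j, i.2, j.2, ?_⟩
    have hi := i.2
    have hj := j.2
    have hs' := s.2
    have ht' := t.2
    have e1 : (s.1 + i.1) % m = if s.1 + i.1 < m then s.1 + i.1 else s.1 + i.1 - m := by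
      split_ifs with h
      · exact Nat.mod_eq_of_lt h
      · rw [Nat.mod_eq_sub_mod (by omega), Nat.mod_eq_of_lt (by omega)]
    have e2 : (t.1 + j.1) % m = if t.1 + j.1 < m then t.1 + j.1 else t.1 + j.1 - m := by
      split_ifs with h
      · exact Nat.mod_eq_of_lt h
      · rw [Nat.mod_eq_sub_mod (by omega), Nat.mod_eq_of_lt (by omega)]
    rw [e1, e2] at h
    split_ifs at h <;> omega
  let d : Fin m → ℕ := fun t => if z.1 ≤ t.1 then t.1 - z.1 else t.1 + m - z.1
  let f : Fin m → ℕ := fun t => if d t < k then d t else d t + k - m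
  have : #T ≤ #(range k) := by
    apply card_le_card_of_injOn f
    · intro t ht
      obtain ⟨i, j, hi, hj, h⟩ := hT' z hz t ht
      have := t.2
      have := z.2
      simp only [coe_range, Set.mem_Iio, f, d]
      split_ifs <;> omega
    · intro s hs t ht hst
      obtain ⟨i, j, hi, hj, h⟩ := hT' z hz t ht
      obtain ⟨i', j', hi', hj', h'⟩ := hT' z hz s hs
      obtain ⟨i'', j'', hi'', hj'', h''⟩ := hT' s hs t ht
      have := t.2
      have := z.2
      have := s.2
      apply Fin.ext
      simp only [f, d] at hst
      split_ifs at hst <;> omega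
  simpa using this

lemma edge_periodic (n x : ℕ) (hn : 0 < n) :
    (x % (n * n)) % n = x % n ∧
    (x % (n * n) + x % (n * n) / n) % n = (x + x / n) % n := by
  have h := Nat.mod_add_div x (n * n)
  set y := x % (n * n)
  set q := x / (n * n)
  have e : x = y + n * (n * q) := by rw [← h]; ring
  constructor
  · rw [e]; simp
  · rw [e, Nat.add_mul_div_left _ _ hn]
    have : y + n * (n * q) + (y / n + n * q) = y + y / n + n * (n * q + q) := by ring
    rw [this]; simp

lemma edge_inj (n x y : ℕ) (hn : 0 < n) (h1 : x % n = y % n)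
    (h2 : (x + x / n) % n = (y + y / n) % n) : x % (n * n) = y % (n * n) := by
  have h3 : x / n ≡ y / n [MOD n] := Nat.ModEq.add_left_cancel (a := x) (b := y) h1 h2
  rw [Nat.mod_mul, Nat.mod_mul, h1, h3]

lemma add_div_bound (n x j : ℕ) (hn : 0 < n) (hj : j < n) :
    (x + j) / n = x / n ∨ (x + j) / n = x / n + 1 := by
  have h1 : x / n ≤ (x + j) / n := Nat.div_le_div_right (by omega)
  have h2 : (x + j) / n ≤ (x + n) / n := Nat.div_le_div_right (by omega)
  rw [Nat.add_div_right _ hn] at h2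
  omega

lemma not_modEq (n a b : ℕ) (h1 : a < b) (h2 : b < a + n) : a % n ≠ b % n := by
  intro h
  have := (Nat.modEq_iff_dvd' h1.le).1 h
  have := Nat.le_of_dvd (by omega) this
  omega

lemma ekr_small (n k : ℕ) (hk : 0 < k) (hn : k < n) :
    IsEKRFamily (completeBipartiteGraph (Fin n) (Fin n)).edgeSet (bipMatchingFamily n k) := by
  have hn0 : 0 < n := by omega
  have hm : 0 < n * n := by positivity
  have h2k : 2 * k ≤ n * n := by nlinarith
  haveI : Nonempty (Fin (n * n)) := ⟨⟨0, hm⟩⟩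
  refine ekr_key hn.le (ι := Fin (n * n))
    (fun t j => ⟨(t.1 + j.1) % n, Nat.mod_lt _ hn0⟩)
    (fun t j => ⟨((t.1 + j.1) + (t.1 + j.1) / n) % n, Nat.mod_lt _ hn0⟩) ?_ ?_ k ?_ ?_
  · intro t i j h
    simp only [Fin.mk.injEq] at h
    have hi := i.2
    have hj := j.2
    rcases lt_trichotomy i.1 j.1 with hl | hl | hl
    · exact absurd h (not_modEq _ _ _ (by omega) (by omega))
    · exact Fin.ext hl
    · exact absurd h.symm (not_modEq _ _ _ (by omega) (by omega))
  · intro t i j h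
    simp only [Fin.mk.injEq] at h
    have hlt : ∀ i j : Fin k, i.1 < j.1 →
        (t.1 + i.1 + (t.1 + i.1) / n) % n ≠ (t.1 + j.1 + (t.1 + j.1) / n) % n := by
      intro i j hij
      have hi := i.2
      have hj := j.2
      have := add_div_bound n (t.1 + i.1) (j.1 - i.1) hn0 (by omega)
      rw [show t.1 + i.1 + (j.1 - i.1) = t.1 + j.1 by omega] at this
      apply not_modEq <;> omega
    rcases lt_trichotomy i.1 j.1 with hl | hl | hl
    · exact absurd h (hlt _ _ hl)
    · exact Fin.ext hl
    · exact absurd h.symm (hlt _ _ hl)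
  · intro T hT
    apply arcs_le _ _ h2k
    intro s hs t ht
    obtain ⟨i, j, h1, h2⟩ := hT s hs t ht
    simp only [Fin.mk.injEq] at h1 h2
    exact ⟨i, j, edge_inj _ _ _ hn0 h1 h2⟩
  · intro x y
    obtain ⟨q, hq⟩ : ∃ q, (x.1 + q) % n = y.1 :=
      ⟨n - x.1 + y.1, by
        have := x.2
        rw [show x.1 + (n - x.1 + y.1) = y.1 + n by omega, Nat.add_mod_right,
          Nat.mod_eq_of_lt y.2]⟩
    have hx := x.2
    let u := (x.1 + n * q) % (n * n)
    have hu : u < n * n := Nat.mod_lt _ hm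
    have hu1 : u % n = x.1 := by
      rw [(edge_periodic n _ hn0).1]; simp [Nat.mod_eq_of_lt hx]
    have hu2 : (u + u / n) % n = y.1 := by
      rw [(edge_periodic n _ hn0).2, Nat.add_mul_div_left _ _ hn0, Nat.div_eq_of_lt hx,
        show x.1 + n * q + (0 + q) = x.1 + q + n * q by ring, Nat.add_mul_mod_self_left, hq]
    let F : Fin k → Fin (n * n) := fun j => ⟨(u + n * n - j.1) % (n * n), Nat.mod_lt _ hm⟩
    have hF : F.Injective := by
      intro i j h
      simp only [F, Fin.mk.injEq] at h
      have hi := i.2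
      have hj := j.2
      rcases lt_trichotomy i.1 j.1 with hl | hl | hl
      · exact absurd h.symm (not_modEq _ _ _ (by omega) (by omega))
      · exact Fin.ext hl
      · exact absurd h (not_modEq _ _ _ (by omega) (by omega))
    refine ⟨univ.image F, by rw [card_image_of_injective _ hF]; simp, ?_⟩
    intro t ht
    simp only [mem_image, mem_univ, true_and] at ht
    obtain ⟨j, rfl⟩ := ht
    have hj := j.2
    have hmod : ((F j).1 + j.1) % (n * n) = u := by
      simp only [F]
      rw [Nat.mod_add_mod, show u + n * n - j.1 + j.1 = u + n * n by omega, Nat.add_mod_right,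
        Nat.mod_eq_of_lt hu]
    refine ⟨j, Fin.ext ?_, Fin.ext ?_⟩
    · simp only
      rw [← (edge_periodic n _ hn0).1, hmod, hu1]
    · simp only
      rw [← (edge_periodic n _ hn0).2, hmod, hu2]

end EKRHelpers

/-- For all positive integers `n` and `k` with `n ≥ k`, the family of all `k`-matchings of the
complete bipartite graph `K_{n,n}` is an EKR family. -/
theorem bipMatchings_isEKR (n k : ℕ) (hk : 0 < k) (hn : k ≤ n) :
    IsEKRFamily (completeBipartiteGraph (Fin n) (Fin n)).edgeSet (bipMatchingFamily n k) := by
  rcases hn.lt_or_eq with h | rfl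
  · exact ekr_small n k hk h
  · exact ekr_perfect k hk
end
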